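/- Let K_xy ⊂ ℝ^{n+m} and K_yz ⊂ ℝ^{m+p} be compact, and assume K has nonempty interior. Suppose there exists a scalar N ∈ ℝ such that N − ‖(Y,Z)‖² ∈ Q(h). If f ∈ ℝ[X,Y] + ℝ[Y,Z] and f(x,y,z) > 0 for all (x,y,z) ∈ K, then f ∈ P(g) + Q(h), i.e. f = σ + ψ for some σ ∈ P(g) and ψ ∈ Q(h). -/

import Mathlib

open MvPolynomial

/-- A polynomial is a sum of squares. -/
def IsSOS {ι : Type*} (q : MvPolynomial ι ℝ) : Prop :=
  ∃ (k : ℕ) (s : Fin k → MvPolynomial ι ℝ), q = ∑ i, (s i) ^ 2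

/-- Membership in the preordering generated by a finite family `g`:
`σ = Σ_{J ⊆ I} σ_J ∏_{j ∈ J} g_j` with each `σ_J` a sum of squares. -/
def InPreordering {ι κ : Type*} [Fintype κ] [DecidableEq κ]
    (g : κ → MvPolynomial ι ℝ) (σ : MvPolynomial ι ℝ) : Prop :=
  ∃ c : Finset κ → MvPolynomial ι ℝ,
    (∀ J, IsSOS (c J)) ∧ σ = ∑ J : Finset κ, c J * ∏ j ∈ J, g j

/-- Membership in the quadratic module generated by a finite family `g`:
`σ = σ₀ + Σ_j σ_j g_j` with `σ₀` and each `σ_j` sums of squares. -/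
def InQuadraticModule {ι κ : Type*} [Fintype κ]
    (g : κ → MvPolynomial ι ℝ) (σ : MvPolynomial ι ℝ) : Prop :=
  ∃ (c₀ : MvPolynomial ι ℝ) (c : κ → MvPolynomial ι ℝ),
    IsSOS c₀ ∧ (∀ j, IsSOS (c j)) ∧ σ = c₀ + ∑ j, c j * g j



/-! ### Polynomials over ordered fields with the intermediate value property -/

/-- The intermediate value property for polynomials. -/
def IVP (R : Type*) [Field R] [LinearOrder R] : Prop :=
  ∀ (p : Polynomial R) (a b : R), a < b → p.eval a < 0 → 0 < p.eval b →
    ∃ c, a < c ∧ c < b ∧ p.eval c = 0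

section RCF
variable {R : Type*} [Field R] [LinearOrder R] [IsStrictOrderedRing R]

lemma IVP.of_mul_neg (hR : IVP R) (p : Polynomial R) {a b : R} (hab : a < b)
    (h : p.eval a * p.eval b < 0) : ∃ c, a < c ∧ c < b ∧ p.eval c = 0 := by
  rcases mul_neg_iff.1 h with ⟨h1, h2⟩ | ⟨h1, h2⟩
  · obtain ⟨c, h3, h4, h5⟩ := hR (-p) a b hab (by simpa using h1) (by simpa using h2)
    exact ⟨c, h3, h4, by simpa using h5⟩
  · exact hR p a b hab h1 h2

lemma IVP.rolle (hR : IVP R) (p : Polynomial R) {a b : R} (hab : a < b)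
    (ha : p.eval a = 0) (hb : p.eval b = 0) :
    ∃ c, a < c ∧ c < b ∧ p.derivative.eval c = 0 := by
  classical
  by_cases hp : p = 0
  · obtain ⟨c, h1, h2⟩ := exists_between hab
    exact ⟨c, h1, h2, by simp [hp]⟩
  -- reduce to consecutive roots
  have hne : (p.roots.toFinset.filter (fun x => a < x)).Nonempty :=
    ⟨b, by simp [hp, hb, hab]⟩
  set b' := (p.roots.toFinset.filter (fun x => a < x)).min' hne with hb'
  have hb'm := Finset.min'_mem _ hne
  rw [← hb'] at hb'm
  have hb'b : b' ≤ b := Finset.min'_le _ _ (by simp [hp, hb, hab])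
  have hmin : ∀ c, a < c → c < b' → p.eval c ≠ 0 := by
    intro c h1 h2 h3
    exact absurd (Finset.min'_le (p.roots.toFinset.filter (fun x => a < x)) c (by simp [hp, h3, h1]))
      (not_le.2 h2)
  simp only [Finset.mem_filter, Multiset.mem_toFinset, Polynomial.mem_roots hp,
    Polynomial.IsRoot.def] at hb'm
  obtain ⟨hb0, hab'⟩ := hb'm
  obtain ⟨q1, hq1, hq1'⟩ := Polynomial.exists_eq_pow_rootMultiplicity_mul_and_not_dvd p hp a
  have hm : 0 < p.rootMultiplicity a := (Polynomial.rootMultiplicity_pos hp).2 ha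
  set m := p.rootMultiplicity a with hmdef
  have hq10 : q1 ≠ 0 := by rintro rfl; simp at hq1'
  have hq1b : q1.eval b' = 0 := by
    have := hb0
    rw [hq1] at this
    simpa [sub_eq_zero, hab'.ne', hm.ne'] using this
  obtain ⟨q, hq, hq'⟩ := Polynomial.exists_eq_pow_rootMultiplicity_mul_and_not_dvd q1 hq10 b'
  have hn : 0 < q1.rootMultiplicity b' := (Polynomial.rootMultiplicity_pos hq10).2 hq1b
  set n := q1.rootMultiplicity b' with hndef
  have hqb : q.eval b' ≠ 0 := fun h => hq' (Polynomial.dvd_iff_isRoot.2 h)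
  have hqa : q.eval a ≠ 0 := fun h => hq1' (by
    rw [hq]; exact Dvd.dvd.mul_left (Polynomial.dvd_iff_isRoot.2 h) _)
  have hsame : 0 < q.eval a * q.eval b' := by
    rcases lt_trichotomy (q.eval a * q.eval b') 0 with h | h | h
    · obtain ⟨c, h1, h2, h3⟩ := hR.of_mul_neg q hab' h
      exact absurd (by rw [hq1, hq]; simp [h3]) (hmin c h1 h2)
    · exact absurd h (mul_ne_zero hqa hqb)
    · exact h
  set r : Polynomial R := (m : Polynomial R) * (Polynomial.X - Polynomial.C b') * q
    + (n : Polynomial R) * (Polynomial.X - Polynomial.C a) * q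
    + (Polynomial.X - Polynomial.C a) * (Polynomial.X - Polynomial.C b') * q.derivative with hr
  have hd : p.derivative = (Polynomial.X - Polynomial.C a) ^ (m - 1) *
      (Polynomial.X - Polynomial.C b') ^ (n - 1) * r := by
    rw [hq1, hq, hr]
    obtain ⟨m', hm'⟩ := Nat.exists_eq_succ_of_ne_zero hm.ne'
    obtain ⟨n', hn'⟩ := Nat.exists_eq_succ_of_ne_zero hn.ne'
    rw [hm', hn']
    simp only [Polynomial.derivative_mul, Polynomial.derivative_X_sub_C_pow, Nat.succ_eq_add_one,
      Nat.add_sub_cancel, map_natCast]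
    ring
  have hra : r.eval a * r.eval b' < 0 := by
    have e1 : r.eval a = m * (a - b') * q.eval a := by simp [hr]
    have e2 : r.eval b' = n * (b' - a) * q.eval b' := by simp [hr]
    rw [e1, e2]
    have : (m * (a - b') * q.eval a) * (n * (b' - a) * q.eval b')
      = - ((m : R) * n * (b' - a) ^ 2 * (q.eval a * q.eval b')) := by ring
    rw [this]
    have h1 : (0 : R) < m := by exact_mod_cast hm
    have h2 : (0 : R) < n := by exact_mod_cast hn
    have h3 : 0 < b' - a := sub_pos.2 hab'
    have : 0 < (m : R) * n * (b' - a) ^ 2 * (q.eval a * q.eval b') := by positivity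
    linarith
  obtain ⟨c, h1, h2, h3⟩ := hR.of_mul_neg r hab' hra
  exact ⟨c, h1, h2.trans_le hb'b, by rw [hd]; simp [h3]⟩

lemma IVP.mvt (hR : IVP R) (p : Polynomial R) {a b : R} (hab : a < b) :
    ∃ c, a < c ∧ c < b ∧ p.derivative.eval c * (b - a) = p.eval b - p.eval a := by
  obtain ⟨c, h1, h2, h3⟩ := hR.rolle (Polynomial.C (b - a) * (p - Polynomial.C (p.eval a)) -
    Polynomial.C (p.eval b - p.eval a) * (Polynomial.X - Polynomial.C a)) hab (by simp)
    (by simp; ring)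
  refine ⟨c, h1, h2, ?_⟩
  simp at h3
  linear_combination h3

lemma poly_lower_bound (p : Polynomial R) (hp : p ≠ 0) :
    ∃ B c : R, 0 < c ∧ ∀ u, B ≤ |u| → c ≤ |p.eval u| := by
  induction hn : p.natDegree using Nat.strong_induction_on generalizing p with
  | _ n ih =>
    by_cases h0 : p.natDegree = 0
    · rw [Polynomial.eq_C_of_natDegree_eq_zero h0] at hp ⊢
      have : p.coeff 0 ≠ 0 := by simpa using hp
      exact ⟨0, |p.coeff 0|, abs_pos.2 this, fun u _ => by simp⟩
    · have hd : p.divX ≠ 0 := by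
        intro h
        apply h0
        rw [← Polynomial.divX_mul_X_add p, h]; simp
      obtain ⟨B, c, hc, hB⟩ := ih p.divX.natDegree
        (by rw [Polynomial.natDegree_divX_eq_natDegree_tsub_one]; omega) p.divX hd rfl
      refine ⟨max B ((|p.coeff 0| + 1) / c), 1, one_pos, fun u hu => ?_⟩
      have h1 := hB u ((le_max_left _ _).trans hu)
      have h2 := (le_max_right _ _).trans hu
      have h3 : p.eval u = p.divX.eval u * u + p.coeff 0 := by
        conv_lhs => rw [← Polynomial.divX_mul_X_add p]
        simp
      rw [div_le_iff₀ hc] at h2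
      have h4 : |p.divX.eval u * u| ≤ |p.eval u| + |p.coeff 0| := by
        have : p.divX.eval u * u = p.eval u - p.coeff 0 := by rw [h3]; ring
        rw [this]; exact abs_sub _ _
      rw [abs_mul] at h4
      nlinarith [abs_nonneg u]

lemma poly_growth (p : Polynomial R) (hp : p.derivative ≠ 0) (M : R) :
    ∃ B : R, ∀ u, B ≤ |u| → M < |p.eval u| := by
  have hd : p.divX ≠ 0 := by
    intro h
    apply hp
    rw [← Polynomial.divX_mul_X_add p, h]; simp
  obtain ⟨B, c, hc, hB⟩ := poly_lower_bound p.divX hd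
  refine ⟨max B ((|p.coeff 0| + M + 1) / c), fun u hu => ?_⟩
  have h1 := hB u ((le_max_left _ _).trans hu)
  have h2 := (le_max_right _ _).trans hu
  have h3 : p.eval u = p.divX.eval u * u + p.coeff 0 := by
    conv_lhs => rw [← Polynomial.divX_mul_X_add p]
    simp
  rw [div_le_iff₀ hc] at h2
  have h4 : |p.divX.eval u * u| ≤ |p.eval u| + |p.coeff 0| := by
    have : p.divX.eval u * u = p.eval u - p.coeff 0 := by rw [h3]; ring
    rw [this]; exact abs_sub _ _
  rw [abs_mul] at h4
  nlinarith [abs_nonneg u]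

/-- `u` and `y` have the same position relative to the finite set `S`. -/
def SamePos (S : Finset R) (u y : R) : Prop := ∀ s ∈ S, cmp s u = cmp s y

lemma samePos_iff {S : Finset R} {u y : R} : SamePos S u y ↔
    ∀ s ∈ S, (s < u ↔ s < y) ∧ (u < s ↔ y < s) := by
  constructor
  · intro h s hs
    exact ⟨lt_iff_lt_of_cmp_eq_cmp (h s hs),
      lt_iff_lt_of_cmp_eq_cmp ((cmp_eq_cmp_symm).1 (h s hs))⟩
  · intro h s hs
    obtain ⟨h1, h2⟩ := h s hs
    rcases lt_trichotomy s u with h3 | h3 | h3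
    · rw [cmp_eq_lt_iff _ _ |>.2 h3, cmp_eq_lt_iff _ _ |>.2 (h1.1 h3)]
    · subst h3
      have : s = y := le_antisymm (not_lt.1 fun h => lt_irrefl _ (h2.2 h))
        (not_lt.1 fun h => lt_irrefl _ (h1.2 h))
      rw [this]
    · rw [cmp_eq_gt_iff _ _ |>.2 h3, cmp_eq_gt_iff _ _ |>.2 (h2.1 h3)]

lemma SamePos.between {S : Finset R} {u v w y : R} (hu : SamePos S u y) (hv : SamePos S v y)
    (h1 : u ≤ w) (h2 : w ≤ v) : SamePos S w y := by
  rw [samePos_iff] at *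
  intro s hs
  obtain ⟨a1, a2⟩ := hu s hs
  obtain ⟨b1, b2⟩ := hv s hs
  exact ⟨⟨fun h => b1.1 (h.trans_le h2), fun h => (a1.2 h).trans_le h1⟩,
    ⟨fun h => a2.1 (h1.trans_lt h), fun h => h2.trans_lt (b2.2 h)⟩⟩

lemma exists_nbhd_samePos (S : Finset R) {z : R} (hz : z ∉ S) :
    ∃ u v, u < z ∧ z < v ∧ ∀ y, u < y → y < v → SamePos S y z := by
  classical
  obtain ⟨u, hu1, hu2⟩ := Order.exists_between_finsets (S.filter (· < z)) {z} (by simp)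
  obtain ⟨v, hv1, hv2⟩ := Order.exists_between_finsets {z} (S.filter (z < ·)) (by simp)
  simp only [Finset.mem_filter, Finset.mem_singleton, and_imp, forall_eq] at *
  refine ⟨u, v, hu2, hv1, fun y h1 h2 => samePos_iff.2 fun s hs => ?_⟩
  rcases lt_trichotomy s z with h | h | h
  · have := hu1 s hs h
    exact ⟨⟨fun _ => h, fun _ => this.trans h1⟩,
      ⟨fun h' => absurd (this.trans h1) h'.not_gt, fun h' => absurd h h'.not_gt⟩⟩
  · exact absurd (h ▸ hs) hz
  · have := hv2 s hs h
    exact ⟨⟨fun h' => absurd (h2.trans this) h'.not_gt, fun h' => absurd h h'.not_gt⟩,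
      ⟨fun _ => h, fun _ => h2.trans this⟩⟩

lemma eq_zero_of_samePos (S : Finset R) {z : R} (hz : z ∉ S) (p : Polynomial R)
    (h : ∀ y, SamePos S y z → p.eval y = 0) : p = 0 := by
  obtain ⟨u, v, hu, hv, h1⟩ := exists_nbhd_samePos S hz
  refine Polynomial.eq_zero_of_infinite_isRoot p ((Set.Ioo_infinite (hu.trans hv)).mono ?_)
  exact fun y hy => h y (h1 y hy.1 hy.2)

end RCF


section RCF2
variable {R : Type*} [Field R] [LinearOrder R] [IsStrictOrderedRing R]

lemma mono_on_samePos (hR : IVP R) (S : Finset R) (P : Polynomial R) {y : R}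
    (hP : ∀ u, SamePos S u y → 0 < P.derivative.eval u) {u v : R}
    (huv : u < v) (h : ∀ w, u < w → w < v → SamePos S w y) : P.eval u < P.eval v := by
  obtain ⟨c, h1, h2, h3⟩ := hR.mvt P huv
  have := hP c (h c h1 h2)
  nlinarith [mul_pos this (sub_pos.2 huv)]

lemma left_adj_between (S : Finset R) {y l w : R} (hy : y ∉ S)
    (hmax : ∀ s ∈ S, s < y → s ≤ l)
    (h1 : l < w) (h2 : w ≤ y) : SamePos S w y := by
  rw [samePos_iff]
  intro s hs
  have hsy : s ≠ y := fun h => hy (h ▸ hs)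
  rcases lt_or_gt_of_ne hsy with h | h
  · have := (hmax s hs h).trans_lt h1
    exact ⟨⟨fun _ => h, fun _ => this⟩,
      ⟨fun h' => absurd this h'.not_gt, fun h' => absurd h h'.not_gt⟩⟩
  · have := h2.trans_lt h
    exact ⟨⟨fun h' => absurd this h'.not_gt, fun h' => absurd h h'.not_gt⟩,
      ⟨fun _ => h, fun _ => this⟩⟩

lemma right_adj_between (S : Finset R) {y r w : R} (hy : y ∉ S)
    (hmin : ∀ s ∈ S, y < s → r ≤ s)
    (h1 : w < r) (h2 : y ≤ w) : SamePos S w y := by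
  rw [samePos_iff]
  intro s hs
  have hsy : s ≠ y := fun h => hy (h ▸ hs)
  rcases lt_or_gt_of_ne hsy with h | h
  · have := h.trans_le h2
    exact ⟨⟨fun _ => h, fun _ => this⟩,
      ⟨fun h' => absurd this h'.not_gt, fun h' => absurd h h'.not_gt⟩⟩
  · have := h1.trans_le (hmin s hs h)
    exact ⟨⟨fun h' => absurd this h'.not_gt, fun h' => absurd h h'.not_gt⟩,
      ⟨fun _ => h, fun _ => this⟩⟩

lemma exists_left_witness (hR : IVP R) (S : Finset R) (P : Polynomial R) {y : R} (hy : y ∉ S)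
    (hP : ∀ u, SamePos S u y → 0 < P.derivative.eval u)
    (hl : ∀ l ∈ S, l < y → (∀ s ∈ S, s < y → s ≤ l) → P.eval l < 0) :
    ∃ u, u ≤ y ∧ P.eval u < 0 ∧ ∀ w, u < w → w ≤ y → SamePos S w y := by
  classical
  by_cases hne : (S.filter (· < y)).Nonempty
  · have hm := Finset.max'_mem _ hne
    set l := (S.filter (· < y)).max' hne with hldef
    simp only [Finset.mem_filter] at hm
    have hmax : ∀ s ∈ S, s < y → s ≤ l := fun s hs hsy =>
      Finset.le_max' _ _ (by simp [hs, hsy])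
    exact ⟨l, hm.2.le, hl l hm.1 hm.2 hmax, fun w h1 h2 => left_adj_between S hy hmax h1 h2⟩
  · have hall : ∀ s ∈ S, ¬ s < y := fun s hs h => hne ⟨s, by simp [hs, h]⟩
    have hsp : ∀ w, w ≤ y → SamePos S w y := fun w hw =>
      left_adj_between (l := w - 1) S hy (fun s hs h => absurd h (hall s hs)) (by linarith) hw
    have hd : P.derivative ≠ 0 := by
      intro h
      have := hP y (hsp y le_rfl)
      simp [h] at this
    by_cases hPy : P.eval y < 0
    · exact ⟨y, le_rfl, hPy, fun w _ h2 => hsp w h2⟩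
    obtain ⟨B, hB⟩ := poly_growth P hd (P.eval y)
    set u := min (-|B|) (y - 1) with hu
    have hu1 : u ≤ -|B| := min_le_left _ _
    have hu2 : u < y := (min_le_right _ _).trans_lt (by linarith)
    have h1 := hB u (by
      have : u ≤ 0 := hu1.trans (by simp)
      rw [abs_of_nonpos this]
      linarith [le_abs_self B])
    have h2 := mono_on_samePos hR S P hP hu2 (fun w _ hw => hsp w hw.le)
    refine ⟨u, hu2.le, ?_, fun w _ h2 => hsp w h2⟩
    by_contra h3
    rw [abs_of_nonneg (not_lt.1 h3)] at h1
    linarith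

lemma exists_right_witness (hR : IVP R) (S : Finset R) (P : Polynomial R) {y : R} (hy : y ∉ S)
    (hP : ∀ u, SamePos S u y → 0 < P.derivative.eval u)
    (hl : ∀ r ∈ S, y < r → (∀ s ∈ S, y < s → r ≤ s) → 0 < P.eval r) :
    ∃ v, y ≤ v ∧ 0 < P.eval v ∧ ∀ w, w < v → y ≤ w → SamePos S w y := by
  classical
  by_cases hne : (S.filter (y < ·)).Nonempty
  · have hm := Finset.min'_mem _ hne
    set l := (S.filter (y < ·)).min' hne with hldef
    simp only [Finset.mem_filter] at hm
    have hmax : ∀ s ∈ S, y < s → l ≤ s := fun s hs hsy =>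
      Finset.min'_le _ _ (by simp [hs, hsy])
    exact ⟨l, hm.2.le, hl l hm.1 hm.2 hmax, fun w h1 h2 => right_adj_between S hy hmax h1 h2⟩
  · have hall : ∀ s ∈ S, ¬ y < s := fun s hs h => hne ⟨s, by simp [hs, h]⟩
    have hsp : ∀ w, y ≤ w → SamePos S w y := fun w hw =>
      right_adj_between (r := w + 1) S hy (fun s hs h => absurd h (hall s hs)) (by linarith) hw
    have hd : P.derivative ≠ 0 := by
      intro h
      have := hP y (hsp y le_rfl)
      simp [h] at this
    by_cases hPy : 0 < P.eval y
    · exact ⟨y, le_rfl, hPy, fun w _ h2 => hsp w h2⟩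
    obtain ⟨B, hB⟩ := poly_growth P hd (-P.eval y)
    set u := max (|B|) (y + 1) with hu
    have hu1 : |B| ≤ u := le_max_left _ _
    have hu2 : y < u := lt_of_lt_of_le (by linarith) (le_max_right _ _)
    have h1 := hB u (by
      have : 0 ≤ u := (abs_nonneg B).trans hu1
      rw [abs_of_nonneg this]
      linarith [le_abs_self B])
    have h2 := mono_on_samePos hR S P hP hu2 (fun w hw _ => hsp w hw.le)
    refine ⟨u, hu2.le, ?_, fun w _ h2 => hsp w h2⟩
    by_contra h3
    rw [abs_of_nonpos (not_lt.1 h3)] at h1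
    linarith

lemma exists_root_samePos (hR : IVP R) (S : Finset R) (P : Polynomial R) {y : R} (hy : y ∉ S)
    (hP : ∀ u, SamePos S u y → 0 < P.derivative.eval u)
    (hl : ∀ l ∈ S, l < y → (∀ s ∈ S, s < y → s ≤ l) → P.eval l < 0)
    (hr : ∀ r ∈ S, y < r → (∀ s ∈ S, y < s → r ≤ s) → 0 < P.eval r) :
    ∃ z, SamePos S z y ∧ P.eval z = 0 := by
  obtain ⟨u, hu1, hu2, hu3⟩ := exists_left_witness hR S P hy hP hl
  obtain ⟨v, hv1, hv2, hv3⟩ := exists_right_witness hR S P hy hP hr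
  have huv : u < v := by
    rcases (hu1.trans hv1).lt_or_eq with h | h
    · exact h
    · subst h; exact absurd hu2 hv2.not_gt
  obtain ⟨c, h1, h2, h3⟩ := hR P u v huv hu2 hv2
  refine ⟨c, ?_, h3⟩
  rcases le_total c y with h | h
  · exact hu3 c h1 h
  · exact hv3 c h2 h

lemma sign_of_left (hR : IVP R) (S : Finset R) (P : Polynomial R) {y l : R} (hy : y ∉ S)
    (hP : ∀ u, SamePos S u y → 0 < P.derivative.eval u)
    (hly : l < y) (hmax : ∀ s ∈ S, s < y → s ≤ l) (h : 0 ≤ P.eval l) : 0 < P.eval y :=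
  h.trans_lt (mono_on_samePos hR S P hP hly fun w h1 h2 => left_adj_between S hy hmax h1 h2.le)

lemma sign_of_right (hR : IVP R) (S : Finset R) (P : Polynomial R) {y r : R} (hy : y ∉ S)
    (hP : ∀ u, SamePos S u y → 0 < P.derivative.eval u)
    (hly : y < r) (hmin : ∀ s ∈ S, y < s → r ≤ s) (h : P.eval r ≤ 0) : P.eval y < 0 :=
  (mono_on_samePos hR S P hP hly fun w h1 h2 => right_adj_between S hy hmin h2 h1.le).trans_le h

lemma sign_of_root (hR : IVP R) (S : Finset R) (P : Polynomial R) {y z : R}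
    (hP : ∀ u, SamePos S u y → 0 < P.derivative.eval u)
    (hz : SamePos S z y) (h : P.eval z = 0) :
    SignType.sign (P.eval y) = SignType.sign (y - z) := by
  have hyy : SamePos S y y := fun _ _ => rfl
  rcases lt_trichotomy y z with h1 | h1 | h1
  · have := mono_on_samePos hR S P hP h1 (fun w h1 h2 => hyy.between hz h1.le h2.le)
    rw [sign_neg (by linarith), sign_neg (by linarith)]
  · subst h1; simp [h]
  · have := mono_on_samePos hR S P hP h1 (fun w h1 h2 => hz.between hyy h1.le h2.le)
    rw [sign_pos (by linarith), sign_pos (by linarith)]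
end RCF2

section Diag
variable {R₁ : Type*} [Field R₁] [LinearOrder R₁] [IsStrictOrderedRing R₁]
variable {R₂ : Type*} [Field R₂] [LinearOrder R₂] [IsStrictOrderedRing R₂]

/-- Two points have the same position relative to the partial isomorphism. -/
def PRel (S : Order.PartialIso R₁ R₂) (y : R₁) (y' : R₂) : Prop :=
  ∀ s ∈ S.val, cmp s.1 y = cmp s.2 y'

noncomputable def dom₁ (S : Order.PartialIso R₁ R₂) : Finset R₁ := by
  classical exact S.val.image Prod.fst
noncomputable def dom₂ (S : Order.PartialIso R₁ R₂) : Finset R₂ := by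
  classical exact S.val.image Prod.snd

lemma mem_dom₁ {S : Order.PartialIso R₁ R₂} {y : R₁} : y ∈ dom₁ S ↔ ∃ s ∈ S.val, s.1 = y := by
  classical simp only [dom₁, Finset.mem_image]
lemma mem_dom₂ {S : Order.PartialIso R₁ R₂} {y : R₂} : y ∈ dom₂ S ↔ ∃ s ∈ S.val, s.2 = y := by
  classical simp only [dom₂, Finset.mem_image]

lemma PRel.left {S : Order.PartialIso R₁ R₂} {y u : R₁} {y' : R₂} (h : PRel S y y')
    (hu : SamePos (dom₁ S) u y) : PRel S u y' := fun s hs =>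
  (hu s.1 (mem_dom₁.2 ⟨s, hs, rfl⟩)).trans (h s hs)
lemma PRel.right {S : Order.PartialIso R₁ R₂} {y : R₁} {y' u : R₂} (h : PRel S y y')
    (hu : SamePos (dom₂ S) u y') : PRel S y u := fun s hs =>
  (h s hs).trans (hu s.2 (mem_dom₂.2 ⟨s, hs, rfl⟩)).symm
lemma PRel.lt_iff {S : Order.PartialIso R₁ R₂} {y : R₁} {y' : R₂} (h : PRel S y y')
    {s : R₁ × R₂} (hs : s ∈ S.val) : s.1 < y ↔ s.2 < y' := lt_iff_lt_of_cmp_eq_cmp (h s hs)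
lemma PRel.gt_iff {S : Order.PartialIso R₁ R₂} {y : R₁} {y' : R₂} (h : PRel S y y')
    {s : R₁ × R₂} (hs : s ∈ S.val) : y < s.1 ↔ y' < s.2 :=
  lt_iff_lt_of_cmp_eq_cmp (cmp_eq_cmp_symm.1 (h s hs))
lemma PRel.eq_iff {S : Order.PartialIso R₁ R₂} {y : R₁} {y' : R₂} (h : PRel S y y')
    {s : R₁ × R₂} (hs : s ∈ S.val) : s.1 = y ↔ s.2 = y' := by
  rw [← cmp_eq_eq_iff, h s hs, cmp_eq_eq_iff]

lemma piso_le_iff (S : Order.PartialIso R₁ R₂) {s t : R₁ × R₂} (hs : s ∈ S.val) (ht : t ∈ S.val) :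
    s.1 ≤ t.1 ↔ s.2 ≤ t.2 := by
  rw [← not_lt, ← not_lt, lt_iff_lt_of_cmp_eq_cmp (S.2 t ht s hs)]

lemma exists_prel (S : Order.PartialIso R₁ R₂) (y : R₁) : ∃ y' : R₂, PRel S y y' :=
  Order.PartialIso.exists_across S y

lemma exists_prel' (S : Order.PartialIso R₁ R₂) (y' : R₂) : ∃ y : R₁, PRel S y y' := by
  classical
  obtain ⟨y, hy⟩ := Order.PartialIso.exists_across S.comm y'
  refine ⟨y, fun s hs => ?_⟩
  have := hy (s.2, s.1) (by
    change _ ∈ S.val.image _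
    exact Finset.mem_image.2 ⟨s, hs, rfl⟩)
  exact this.symm

/-- `S` is a common sign diagram for the pairs of polynomials in `T`. -/
def Diag (T : Set (Polynomial R₁ × Polynomial R₂)) (S : Order.PartialIso R₁ R₂) : Prop :=
  (∀ s ∈ S.val, ∃ t ∈ T, t.1 ≠ 0 ∧ t.2 ≠ 0 ∧ t.1.eval s.1 = 0 ∧ t.2.eval s.2 = 0) ∧
  ∀ y y', PRel S y y' → ∀ t ∈ T, SignType.sign (t.1.eval y) = SignType.sign (t.2.eval y')

lemma Diag.sign_self {T : Set (Polynomial R₁ × Polynomial R₂)} {S : Order.PartialIso R₁ R₂}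
    (h : Diag T S) {s} (hs : s ∈ S.val) {t} (ht : t ∈ T) :
    SignType.sign (t.1.eval s.1) = SignType.sign (t.2.eval s.2) :=
  h.2 _ _ (fun r hr => S.2 r hr s hs) t ht

lemma Diag.root_mem₁ {T : Set (Polynomial R₁ × Polynomial R₂)} {S : Order.PartialIso R₁ R₂}
    (h : Diag T S) {t} (ht : t ∈ T) (h0 : t.1 ≠ 0) {z : R₁} (hz : t.1.eval z = 0) :
    ∃ s ∈ S.val, s.1 = z := by
  by_contra hc
  rw [← mem_dom₁] at hc
  obtain ⟨z', hz'⟩ := exists_prel S z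
  refine h0 (eq_zero_of_samePos _ hc t.1 fun y hy => ?_)
  have h1 := h.2 _ _ hz' t ht
  have h2 := h.2 _ _ (hz'.left hy) t ht
  rw [hz, sign_zero] at h1
  rw [← h1] at h2
  exact sign_eq_zero_iff.1 h2

lemma Diag.root_mem₂ {T : Set (Polynomial R₁ × Polynomial R₂)} {S : Order.PartialIso R₁ R₂}
    (h : Diag T S) {t} (ht : t ∈ T) (h0 : t.2 ≠ 0) {z' : R₂} (hz : t.2.eval z' = 0) :
    ∃ s ∈ S.val, s.2 = z' := by
  by_contra hc
  rw [← mem_dom₂] at hc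
  obtain ⟨z, hz'⟩ := exists_prel' S z'
  refine h0 (eq_zero_of_samePos _ hc t.2 fun y hy => ?_)
  have h1 := h.2 _ _ hz' t ht
  have h2 := h.2 _ _ (hz'.right hy) t ht
  rw [hz, sign_zero] at h1
  rw [h1] at h2
  exact sign_eq_zero_iff.1 h2.symm

lemma Diag.eq_zero {T : Set (Polynomial R₁ × Polynomial R₂)} {S : Order.PartialIso R₁ R₂}
    (h : Diag T S) {t} (ht : t ∈ T) (h0 : t.1 = 0) : t.2 = 0 := by
  refine Polynomial.funext fun y' => ?_
  obtain ⟨y, hy⟩ := exists_prel' S y'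
  have h1 := h.2 _ _ hy t ht
  rw [h0] at h1
  simp only [Polynomial.eval_zero, sign_zero] at h1
  simpa using sign_eq_zero_iff.1 h1.symm

lemma IVP.root_of_sign_ne {R : Type*} [Field R] [LinearOrder R] [IsStrictOrderedRing R]
    (hR : IVP R) (p : Polynomial R) {a b : R}
    (h : SignType.sign (p.eval a) ≠ SignType.sign (p.eval b)) :
    ∃ c, min a b ≤ c ∧ c ≤ max a b ∧ p.eval c = 0 := by
  wlog hab : a ≤ b generalizing a b
  · rw [min_comm, max_comm]
    exact this h.symm (le_of_not_ge hab)
  rw [min_eq_left hab, max_eq_right hab]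
  have hab' : a < b := lt_of_le_of_ne hab (by rintro rfl; exact h rfl)
  by_cases ha : p.eval a = 0
  · exact ⟨a, le_rfl, hab, ha⟩
  by_cases hb : p.eval b = 0
  · exact ⟨b, hab, le_rfl, hb⟩
  have : p.eval a * p.eval b < 0 := by
    rcases lt_or_gt_of_ne ha with h1 | h1 <;> rcases lt_or_gt_of_ne hb with h2 | h2
    · simp [sign_neg h1, sign_neg h2] at h
    · exact mul_neg_of_neg_of_pos h1 h2
    · exact mul_neg_of_pos_of_neg h1 h2
    · simp [sign_pos h1, sign_pos h2] at h
  obtain ⟨c, h1, h2, h3⟩ := hR.of_mul_neg p hab' this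
  exact ⟨c, h1.le, h2.le, h3⟩

lemma Diag.drop (hR₂ : IVP R₂) {T T₀ : Set (Polynomial R₁ × Polynomial R₂)}
    {S : Order.PartialIso R₁ R₂} (h : Diag T S) (hT : T₀ ⊆ T) :
    ∃ S₀ : Order.PartialIso R₁ R₂, Diag T₀ S₀ ∧ S₀.val ⊆ S.val := by
  classical
  refine ⟨⟨S.val.filter (fun s => ∃ t ∈ T₀, t.1 ≠ 0 ∧ t.2 ≠ 0 ∧ t.1.eval s.1 = 0 ∧ t.2.eval s.2 = 0),
    fun p hp q hq => S.2 p (Finset.mem_filter.1 hp).1 q (Finset.mem_filter.1 hq).1⟩, ⟨?_, ?_⟩, ?_⟩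
  · intro s hs
    exact (Finset.mem_filter.1 hs).2
  · intro y y' hyy t ht
    obtain ⟨y'', hy''⟩ := exists_prel S y
    rw [h.2 _ _ hy'' t (hT ht)]
    by_contra hne
    obtain ⟨z', h1, h2, h3⟩ := hR₂.root_of_sign_ne t.2 hne
    have ht2 : t.2 ≠ 0 := by intro h0; simp [h0] at hne
    have ht1 : t.1 ≠ 0 := fun h0 => ht2 (h.eq_zero (hT ht) h0)
    obtain ⟨s, hs, rfl⟩ := h.root_mem₂ (hT ht) ht2 h3
    have h4 := h.sign_self hs (hT ht)
    rw [h3, sign_zero, sign_eq_zero_iff] at h4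
    have hc := (hy'' s hs).symm.trans (hyy s (Finset.mem_filter.2 ⟨hs, t, ht, ht1, ht2, h4, h3⟩))
    have e1 := lt_iff_lt_of_cmp_eq_cmp hc
    have e2 := lt_iff_lt_of_cmp_eq_cmp (cmp_eq_cmp_symm.1 hc)
    have hney : y'' ≠ y' := by rintro rfl; exact hne rfl
    rcases lt_or_gt_of_ne hney with h5 | h5
    · rw [min_eq_left h5.le] at h1
      rw [max_eq_right h5.le] at h2
      have h6 : ¬ s.2 < y' := fun h => absurd (e1.2 h) h1.not_gt
      have h7 : s.2 = y' := le_antisymm h2 (not_lt.1 h6)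
      exact absurd (e2.1 (h7 ▸ h5)) (by simp [h7])
    · rw [min_eq_right h5.le] at h1
      rw [max_eq_left h5.le] at h2
      have h6 : ¬ y' < s.2 := fun h => absurd (e2.2 h) h2.not_gt
      have h7 : s.2 = y' := le_antisymm (not_lt.1 h6) h1
      exact absurd (e1.1 (h7 ▸ h5)) (by simp [h7])
  · exact Finset.filter_subset _ _

lemma sign_eq_of_pos_deriv (hR₁ : IVP R₁) (hR₂ : IVP R₂) (S : Order.PartialIso R₁ R₂)
    (P : Polynomial R₁) (Q : Polynomial R₂) {y : R₁} {y' : R₂} (hyy : PRel S y y')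
    (hy : y ∉ dom₁ S) (hy' : y' ∉ dom₂ S)
    (hP : ∀ u, SamePos (dom₁ S) u y → 0 < P.derivative.eval u)
    (hQ : ∀ u, SamePos (dom₂ S) u y' → 0 < Q.derivative.eval u)
    (hS : ∀ s ∈ S.val, SignType.sign (P.eval s.1) = SignType.sign (Q.eval s.2))
    (hroot : ∀ z z', P.eval z = 0 → Q.eval z' = 0 → PRel S z z' → cmp z y = cmp z' y') :
    SignType.sign (P.eval y) = SignType.sign (Q.eval y') := by
  have hneg : ∀ s ∈ S.val, (P.eval s.1 < 0 ↔ Q.eval s.2 < 0) := fun s hs => by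
    rw [← sign_eq_neg_one_iff, ← sign_eq_neg_one_iff, hS s hs]
  have hpos : ∀ s ∈ S.val, (0 < P.eval s.1 ↔ 0 < Q.eval s.2) := fun s hs => by
    rw [← sign_eq_one_iff, ← sign_eq_one_iff, hS s hs]
  have adjl : ∀ s ∈ S.val, (∀ r ∈ dom₁ S, r < y → r ≤ s.1) ↔ (∀ r ∈ dom₂ S, r < y' → r ≤ s.2) := by
    intro s hs
    constructor
    · intro h r hr hry
      obtain ⟨t, ht, rfl⟩ := mem_dom₂.1 hr
      exact (piso_le_iff S ht hs).1 (h t.1 (mem_dom₁.2 ⟨t, ht, rfl⟩) ((hyy.lt_iff ht).2 hry))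
    · intro h r hr hry
      obtain ⟨t, ht, rfl⟩ := mem_dom₁.1 hr
      exact (piso_le_iff S ht hs).2 (h t.2 (mem_dom₂.2 ⟨t, ht, rfl⟩) ((hyy.lt_iff ht).1 hry))
  have adjr : ∀ s ∈ S.val, (∀ r ∈ dom₁ S, y < r → s.1 ≤ r) ↔ (∀ r ∈ dom₂ S, y' < r → s.2 ≤ r) := by
    intro s hs
    constructor
    · intro h r hr hry
      obtain ⟨t, ht, rfl⟩ := mem_dom₂.1 hr
      exact (piso_le_iff S hs ht).1 (h t.1 (mem_dom₁.2 ⟨t, ht, rfl⟩) ((hyy.gt_iff ht).2 hry))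
    · intro h r hr hry
      obtain ⟨t, ht, rfl⟩ := mem_dom₁.1 hr
      exact (piso_le_iff S hs ht).2 (h t.2 (mem_dom₂.2 ⟨t, ht, rfl⟩) ((hyy.gt_iff ht).1 hry))
  by_cases hl : ∀ s ∈ S.val, s.1 < y → (∀ r ∈ dom₁ S, r < y → r ≤ s.1) → P.eval s.1 < 0
  swap
  · push Not at hl
    obtain ⟨s, hs, h1, h2, h3⟩ := hl
    rw [sign_pos (sign_of_left hR₁ _ P hy hP h1 h2 h3),
      sign_pos (sign_of_left hR₂ _ Q hy' hQ ((hyy.lt_iff hs).1 h1) ((adjl s hs).1 h2)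
        (not_lt.1 fun h => absurd ((hneg s hs).2 h) h3.not_gt))]
  by_cases hr : ∀ s ∈ S.val, y < s.1 → (∀ r ∈ dom₁ S, y < r → s.1 ≤ r) → 0 < P.eval s.1
  swap
  · push Not at hr
    obtain ⟨s, hs, h1, h2, h3⟩ := hr
    rw [sign_neg (sign_of_right hR₁ _ P hy hP h1 h2 h3),
      sign_neg (sign_of_right hR₂ _ Q hy' hQ ((hyy.gt_iff hs).1 h1) ((adjr s hs).1 h2)
        (not_lt.1 fun h => absurd ((hpos s hs).2 h) h3.not_gt))]
  obtain ⟨z, hz1, hz2⟩ := exists_root_samePos hR₁ _ P hy hP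
    (fun l hl1 h1 h2 => by obtain ⟨s, hs, rfl⟩ := mem_dom₁.1 hl1; exact hl s hs h1 h2)
    (fun l hl1 h1 h2 => by obtain ⟨s, hs, rfl⟩ := mem_dom₁.1 hl1; exact hr s hs h1 h2)
  obtain ⟨z', hz1', hz2'⟩ := exists_root_samePos hR₂ _ Q hy' hQ
    (fun l hl1 h1 h2 => by
      obtain ⟨s, hs, rfl⟩ := mem_dom₂.1 hl1
      exact (hneg s hs).1 (hl s hs ((hyy.lt_iff hs).2 h1) ((adjl s hs).2 h2)))
    (fun l hl1 h1 h2 => by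
      obtain ⟨s, hs, rfl⟩ := mem_dom₂.1 hl1
      exact (hpos s hs).1 (hr s hs ((hyy.gt_iff hs).2 h1) ((adjr s hs).2 h2)))
  have hc := hroot z z' hz2 hz2' ((hyy.left hz1).right hz1')
  rw [sign_of_root hR₁ _ P hP hz1 hz2, sign_of_root hR₂ _ Q hQ hz1' hz2']
  rcases lt_trichotomy z y with h | h | h
  · rw [sign_pos (sub_pos.2 h), sign_pos (sub_pos.2 ((lt_iff_lt_of_cmp_eq_cmp hc).1 h))]
  · have h' : z' = y' := by rwa [← cmp_eq_eq_iff, ← hc, cmp_eq_eq_iff]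
    simp [h, h']
  · rw [sign_neg (sub_neg.2 h),
      sign_neg (sub_neg.2 ((lt_iff_lt_of_cmp_eq_cmp (cmp_eq_cmp_symm.1 hc)).1 h))]

lemma Diag.insert (hR₁ : IVP R₁) (hR₂ : IVP R₂) {T : Set (Polynomial R₁ × Polynomial R₂)}
    {S : Order.PartialIso R₁ R₂} (h : Diag T S) (P : Polynomial R₁) (Q : Polynomial R₂)
    (hPQ : (P.derivative, Q.derivative) ∈ T) (hP : P.derivative ≠ 0) (hQ : Q.derivative ≠ 0)
    (hS : ∀ s ∈ S.val, SignType.sign (P.eval s.1) = SignType.sign (Q.eval s.2)) :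
    ∃ S', Diag (insert (P, Q) T) S' := by
  classical
  have hP0 : P ≠ 0 := by rintro rfl; simp at hP
  have hQ0 : Q ≠ 0 := by rintro rfl; simp at hQ
  set N : Finset (R₁ × R₂) := (P.roots.toFinset ×ˢ Q.roots.toFinset).filter
    (fun s => PRel S s.1 s.2) with hN
  have hNm : ∀ s, s ∈ N ↔ P.eval s.1 = 0 ∧ Q.eval s.2 = 0 ∧ PRel S s.1 s.2 := by
    intro s
    simp [hN, hP0, hQ0, and_assoc]
  have lt12 : ∀ s ∈ N, ∀ t ∈ N, s.1 < t.1 → s.2 < t.2 := by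
    intro s hs t ht hst
    obtain ⟨s1, s2, s3⟩ := (hNm s).1 hs
    obtain ⟨t1, t2, t3⟩ := (hNm t).1 ht
    obtain ⟨c, h1, h2, h3⟩ := hR₁.rolle P hst s1 t1
    obtain ⟨r, hr, rfl⟩ := h.root_mem₁ hPQ hP h3
    exact ((s3.gt_iff hr).1 h1).trans ((t3.lt_iff hr).1 h2)
  have lt21 : ∀ s ∈ N, ∀ t ∈ N, s.2 < t.2 → s.1 < t.1 := by
    intro s hs t ht hst
    obtain ⟨s1, s2, s3⟩ := (hNm s).1 hs
    obtain ⟨t1, t2, t3⟩ := (hNm t).1 ht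
    obtain ⟨c, h1, h2, h3⟩ := hR₂.rolle Q hst s2 t2
    obtain ⟨r, hr, rfl⟩ := h.root_mem₂ hPQ hQ h3
    exact ((s3.gt_iff hr).2 h1).trans ((t3.lt_iff hr).2 h2)
  have hcmpN : ∀ s ∈ N, ∀ t ∈ N, cmp s.1 t.1 = cmp s.2 t.2 := by
    intro s hs t ht
    rcases lt_trichotomy s.1 t.1 with h1 | h1 | h1
    · rw [(cmp_eq_lt_iff _ _).2 h1, (cmp_eq_lt_iff _ _).2 (lt12 s hs t ht h1)]
    · have h2 : s.2 = t.2 := le_antisymm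
        (not_lt.1 fun h => (lt21 t ht s hs h).ne h1.symm)
        (not_lt.1 fun h => (lt21 s hs t ht h).ne h1)
      rw [(cmp_eq_eq_iff _ _).2 h1, (cmp_eq_eq_iff _ _).2 h2]
    · rw [(cmp_eq_gt_iff _ _).2 h1, (cmp_eq_gt_iff _ _).2 (lt12 t ht s hs h1)]
  refine ⟨⟨S.val ∪ N, ?_⟩, ?_, ?_⟩
  · intro s hs t ht
    rcases Finset.mem_union.1 hs with hs | hs <;> rcases Finset.mem_union.1 ht with ht | ht
    · exact S.2 s hs t ht
    · exact ((hNm t).1 ht).2.2 s hs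
    · exact cmp_eq_cmp_symm.1 (((hNm s).1 hs).2.2 t ht)
    · exact hcmpN s hs t ht
  · intro s hs
    rcases Finset.mem_union.1 hs with hs | hs
    · obtain ⟨t, ht, h'⟩ := h.1 s hs
      exact ⟨t, Set.mem_insert_of_mem _ ht, h'⟩
    · exact ⟨(P, Q), Set.mem_insert _ _, hP0, hQ0, ((hNm s).1 hs).1, ((hNm s).1 hs).2.1⟩
  · intro y y' hyy t ht
    have hyS : PRel S y y' := fun s hs => hyy s (Finset.mem_union_left _ hs)
    rcases ht with rfl | ht
    swap
    · exact h.2 y y' hyS t ht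
    change SignType.sign (P.eval y) = SignType.sign (Q.eval y')
    by_cases hy : y ∈ dom₁ S
    · obtain ⟨s, hs, rfl⟩ := mem_dom₁.1 hy
      rw [← (hyS.eq_iff hs).1 rfl]
      exact hS s hs
    by_cases hy' : y' ∈ dom₂ S
    · obtain ⟨s, hs, rfl⟩ := mem_dom₂.1 hy'
      rw [← (hyS.eq_iff hs).2 rfl]
      exact hS s hs
    have hsg := h.2 y y' hyS _ hPQ
    have hu : ∀ u, SamePos (dom₁ S) u y →
        SignType.sign (P.derivative.eval u) = SignType.sign (Q.derivative.eval y') :=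
      fun u hu => h.2 u y' (hyS.left hu) _ hPQ
    have hu' : ∀ u, SamePos (dom₂ S) u y' →
        SignType.sign (P.derivative.eval y) = SignType.sign (Q.derivative.eval u) :=
      fun u hu => h.2 y u (hyS.right hu) _ hPQ
    have hroot : ∀ z z', P.eval z = 0 → Q.eval z' = 0 → PRel S z z' → cmp z y = cmp z' y' :=
      fun z z' h1 h2 h3 => hyy (z, z') (Finset.mem_union_right _ ((hNm _).2 ⟨h1, h2, h3⟩))
    rcases lt_trichotomy (P.derivative.eval y) 0 with h0 | h0 | h0
    · have h1 : Q.derivative.eval y' < 0 := by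
        rw [← sign_eq_neg_one_iff, ← hsg, sign_eq_neg_one_iff]; exact h0
      have := sign_eq_of_pos_deriv hR₁ hR₂ S (-P) (-Q) hyS hy hy'
        (fun u h => by
          have := hu u h
          rw [sign_neg h1, sign_eq_neg_one_iff] at this
          simpa using this)
        (fun u h => by
          have := hu' u h
          rw [sign_neg h0, eq_comm, sign_eq_neg_one_iff] at this
          simpa using this)
        (fun s hs => by
          simp only [Polynomial.eval_neg, Left.sign_neg, hS s hs])
        (fun z z' h1 h2 => hroot z z' (by simpa using h1) (by simpa using h2))
      simpa only [Polynomial.eval_neg, Left.sign_neg, neg_inj] using this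
    · obtain ⟨s, hs, h1⟩ := h.root_mem₁ hPQ hP h0
      exact absurd (mem_dom₁.2 ⟨s, hs, h1⟩) hy
    · have h1 : 0 < Q.derivative.eval y' := by
        rw [← sign_eq_one_iff, ← hsg, sign_eq_one_iff]; exact h0
      exact sign_eq_of_pos_deriv hR₁ hR₂ S P Q hyS hy hy'
        (fun u h => by
          have := hu u h
          rwa [sign_pos h1, sign_eq_one_iff] at this)
        (fun u h => by
          have := hu' u h
          rwa [sign_pos h0, eq_comm, sign_eq_one_iff] at this)
        hS hroot
end Diag


lemma pseudo_div {B : Type*} [CommRing B] (h : Polynomial B) (hh : 0 < h.natDegree)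
    (P : Polynomial B) : ∃ (k : ℕ) (q r : Polynomial B), r.natDegree < h.natDegree ∧
      Polynomial.C (h.leadingCoeff ^ k) * P = q * h + r := by
  induction hn : P.natDegree using Nat.strong_induction_on generalizing P with
  | _ n ih =>
    by_cases hlt : P.natDegree < h.natDegree
    · exact ⟨0, 0, P, hlt, by simp⟩
    set e := P.natDegree with he
    set d := h.natDegree with hd
    set P1 := Polynomial.C h.leadingCoeff * P -
      Polynomial.C P.leadingCoeff * (Polynomial.X ^ (e - d) * h) with hP1
    have hdeg : P1.natDegree ≤ e - 1 := by
      rw [Polynomial.natDegree_le_iff_coeff_eq_zero]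
      intro N hN
      have h1 : e - d ≤ N := by omega
      rw [hP1, Polynomial.coeff_sub, Polynomial.coeff_C_mul, Polynomial.coeff_C_mul,
        Polynomial.coeff_X_pow_mul', if_pos h1]
      rcases (show e ≤ N by omega).eq_or_lt with h2 | h2
      · have : N - (e - d) = d := by omega
        rw [this, ← h2]
        simp only [he, hd, Polynomial.coeff_natDegree]
        ring
      · rw [Polynomial.coeff_eq_zero_of_natDegree_lt h2,
          Polynomial.coeff_eq_zero_of_natDegree_lt (show h.natDegree < N - (e - d) by omega)]
        ring
    obtain ⟨k, q, r, hr, hq⟩ := ih P1.natDegree (by omega) P1 rfl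
    refine ⟨k + 1, q + Polynomial.C (h.leadingCoeff ^ k) * Polynomial.C P.leadingCoeff *
      Polynomial.X ^ (e - d), r, hr, ?_⟩
    rw [hP1] at hq
    simp only [pow_succ, map_mul] at hq ⊢
    linear_combination hq

lemma rem_sign {B R : Type*} [CommRing B] [Field R] [LinearOrder R] [IsStrictOrderedRing R]
    (χ : B →+* R) {h P q r : Polynomial B} {k : ℕ}
    (hq : Polynomial.C (h.leadingCoeff ^ k) * P = q * h + r) (s : R)
    (h5 : χ h.leadingCoeff ≠ 0) (h6 : (h.map χ).eval s = 0) :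
    SignType.sign (((Polynomial.C (h.leadingCoeff ^ k) * r).map χ).eval s) =
      SignType.sign ((P.map χ).eval s) := by
  have e : ((Polynomial.C (h.leadingCoeff ^ k) * r).map χ).eval s =
      ((χ h.leadingCoeff) ^ k) ^ 2 * (P.map χ).eval s := by
    have := congrArg (fun p => (p.map χ).eval s) hq
    simp only [Polynomial.map_mul, Polynomial.map_add, Polynomial.eval_mul, Polynomial.eval_add,
      Polynomial.map_C, Polynomial.eval_C, h6, map_pow, Polynomial.map_pow, Polynomial.eval_pow] at this ⊢
    linear_combination -(χ h.leadingCoeff) ^ k * this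
  have := pow_ne_zero k h5
  rw [e, sign_mul, sign_pos (by positivity), one_mul]

section Horm
variable {R₁ : Type*} [Field R₁] [LinearOrder R₁] [IsStrictOrderedRing R₁]
variable {R₂ : Type*} [Field R₂] [LinearOrder R₂] [IsStrictOrderedRing R₂]
variable {B Ω : Type*} [CommRing B] (φ : B →+* R₁) (F : Filter Ω) (ψ : Ω → B →+* R₂)

lemma horm_trunc (hs : ∀ b, ∀ᶠ ω in F, SignType.sign (ψ ω b) = SignType.sign (φ b))
    (g : Polynomial B) :
    ∃ g' : Polynomial B, g'.natDegree ≤ g.natDegree ∧ (g' = 0 ∨ φ g'.leadingCoeff ≠ 0) ∧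
      g'.map φ = g.map φ ∧ ∀ᶠ ω in F, g'.map (ψ ω) = g.map (ψ ω) := by
  induction hn : g.support.card using Nat.strong_induction_on generalizing g with
  | _ n ih =>
    by_cases h0 : g = 0
    · exact ⟨0, by simp, Or.inl rfl, by simp [h0], by simp [h0]⟩
    by_cases h1 : φ g.leadingCoeff = 0
    · obtain ⟨g', h2, h3, h4, h5⟩ := ih _ (by rw [← hn]; exact Polynomial.eraseLead_support_card_lt h0)
        g.eraseLead rfl
      refine ⟨g', h2.trans (Polynomial.eraseLead_natDegree_le_aux), h3, ?_, ?_⟩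
      · rw [h4]
        have := congrArg (Polynomial.map φ) (Polynomial.eraseLead_add_C_mul_X_pow g)
        rwa [Polynomial.map_add, Polynomial.map_mul, Polynomial.map_C, h1, map_zero, zero_mul,
          add_zero] at this
      · filter_upwards [h5, hs g.leadingCoeff] with ω h5 h6
        rw [h1, sign_zero, sign_eq_zero_iff] at h6
        rw [h5]
        have := congrArg (Polynomial.map (ψ ω)) (Polynomial.eraseLead_add_C_mul_X_pow g)
        rwa [Polynomial.map_add, Polynomial.map_mul, Polynomial.map_C, h6, map_zero, zero_mul,
          add_zero] at this
    · exact ⟨g, le_rfl, Or.inr h1, rfl, by simp⟩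

lemma horm_rem (hs : ∀ b, ∀ᶠ ω in F, SignType.sign (ψ ω b) = SignType.sign (φ b))
    (P h : Polynomial B) {d : ℕ} (hd : h.natDegree ≤ d + 1) :
    ∃ r : Polynomial B, r.natDegree ≤ d ∧ ∀ᶠ ω in F, ∀ s s', h.map φ ≠ 0 →
      (h.map φ).eval s = 0 → (h.map (ψ ω)).eval s' = 0 →
      SignType.sign ((r.map φ).eval s) = SignType.sign ((P.map φ).eval s) ∧
      SignType.sign ((r.map (ψ ω)).eval s') = SignType.sign ((P.map (ψ ω)).eval s') := by
  obtain ⟨h', h1, h2, h3, h4⟩ := horm_trunc φ F ψ hs h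
  rcases h2 with h2 | h2
  · refine ⟨0, by simp, Filter.Eventually.of_forall fun ω s s' h5 => ?_⟩
    exact absurd (by rw [← h3, h2]; simp) h5
  by_cases h0 : h'.natDegree = 0
  · refine ⟨0, by simp, Filter.Eventually.of_forall fun ω s s' _ h5 => ?_⟩
    exfalso
    rw [← h3, Polynomial.eq_C_of_natDegree_eq_zero h0] at h5
    simp only [Polynomial.map_C, Polynomial.eval_C] at h5
    rw [Polynomial.leadingCoeff, h0] at h2
    exact h2 h5
  obtain ⟨k, q, r, hr, hq⟩ := pseudo_div h' (Nat.pos_of_ne_zero h0) P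
  refine ⟨Polynomial.C (h'.leadingCoeff ^ k) * r, ?_, ?_⟩
  · have := Polynomial.natDegree_C_mul_le (h'.leadingCoeff ^ k) r
    omega
  · filter_upwards [h4, hs h'.leadingCoeff] with ω h5 h6 s s' _ h7 h8
    rw [← h3] at h7
    rw [← h5] at h8
    have h9 : ψ ω h'.leadingCoeff ≠ 0 := by
      rw [← sign_ne_zero, h6, sign_ne_zero]; exact h2
    exact ⟨rem_sign φ hq s h2 h7, rem_sign (ψ ω) hq s' h9 h8⟩

/-- The pairs of specialized polynomials. -/
def pairs (G : Set (Polynomial B)) (ω : Ω) : Set (Polynomial R₁ × Polynomial R₂) :=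
  (fun g => (g.map φ, g.map (ψ ω))) '' G

lemma pairs_mono {G G' : Set (Polynomial B)} (h : G ⊆ G') (ω : Ω) :
    pairs φ ψ G ω ⊆ pairs φ ψ G' ω := Set.image_mono h

lemma horm_base (hs : ∀ b, ∀ᶠ ω in F, SignType.sign (ψ ω b) = SignType.sign (φ b))
    (G : Finset (Polynomial B)) (hG : ∀ g ∈ G, g.natDegree ≤ 0) :
    ∀ᶠ ω in F, ∃ S, Diag (pairs φ ψ (G : Set (Polynomial B)) ω) S := by
  have : ∀ᶠ ω in F, ∀ g ∈ G, SignType.sign (ψ ω (g.coeff 0)) = SignType.sign (φ (g.coeff 0)) :=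
    (Filter.eventually_all_finset G).2 fun g _ => hs _
  filter_upwards [this] with ω hω
  refine ⟨⟨∅, by simp⟩, by simp, ?_⟩
  rintro y y' - _ ⟨g, hg, rfl⟩
  have h1 := Polynomial.eq_C_of_natDegree_eq_zero (Nat.le_zero.1 (hG g hg))
  have h2 := hω g hg
  dsimp only
  rw [h1]
  simp [h2]

lemma horm_step (hR₁ : IVP R₁) (hR₂ : IVP R₂)
    (hs : ∀ b, ∀ᶠ ω in F, SignType.sign (ψ ω b) = SignType.sign (φ b)) (d : ℕ)
    (ih : ∀ G : Finset (Polynomial B), (∀ g ∈ G, g.natDegree ≤ d) →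
      ∀ᶠ ω in F, ∃ S, Diag (pairs φ ψ (G : Set (Polynomial B)) ω) S)
    (L : Finset (Polynomial B)) : (∀ g ∈ L, g.natDegree ≤ d + 1) →
      ∀ G : Finset (Polynomial B), (∀ g ∈ G, g.natDegree ≤ d) →
      ∀ᶠ ω in F, ∃ S, Diag (pairs φ ψ (G ∪ L : Set (Polynomial B)) ω) S := by
  classical
  induction L using Finset.induction_on with
  | empty =>
    intro _ G hG
    simpa using ih G hG
  | insert P L0 hPL ihL =>
    intro hL G hG
    have hPd : P.natDegree ≤ d + 1 := hL P (by simp)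
    have hL0 : ∀ g ∈ L0, g.natDegree ≤ d + 1 := fun g hg => hL g (by simp [hg])
    have hP'd : P.derivative.natDegree ≤ d :=
      (Polynomial.natDegree_derivative_le P).trans (by omega)
    set G1 : Finset (Polynomial B) := insert P.derivative (G ∪ L0) with hG1
    have hG1d : ∀ g ∈ G1, g.natDegree ≤ d + 1 := by
      intro g hg
      simp only [hG1, Finset.mem_insert, Finset.mem_union] at hg
      rcases hg with rfl | hg | hg
      · omega
      · exact (hG g hg).trans (by omega)
      · exact hL0 g hg
    have hrem := fun (h : Polynomial B) (hd : h.natDegree ≤ d + 1) =>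
      horm_rem φ F ψ hs P h hd
    choose! rem hrem1 hrem2 using hrem
    set H : Finset (Polynomial B) := insert P.derivative (G ∪ G1.image rem) with hH
    have hHd : ∀ g ∈ H, g.natDegree ≤ d := by
      intro g hg
      simp only [hH, Finset.mem_insert, Finset.mem_union, Finset.mem_image] at hg
      rcases hg with rfl | hg | ⟨h, hh, rfl⟩
      · exact hP'd
      · exact hG g hg
      · exact hrem1 h (hG1d h hh)
    have hrem3 : ∀ᶠ ω in F, ∀ h ∈ G1, ∀ s s', h.map φ ≠ 0 →
      (h.map φ).eval s = 0 → (h.map (ψ ω)).eval s' = 0 →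
      SignType.sign (((rem h).map φ).eval s) = SignType.sign ((P.map φ).eval s) ∧
      SignType.sign (((rem h).map (ψ ω)).eval s') = SignType.sign ((P.map (ψ ω)).eval s') :=
      (Filter.eventually_all_finset G1).2 fun h hh => hrem2 h (hG1d h hh)
    obtain ⟨P', hp1, hp2, hp3, hp4⟩ := horm_trunc φ F ψ hs P.derivative
    have hlead := hs P'.leadingCoeff
    have hc0 := hs (P.coeff 0)
    have hsub1 : (G1 : Set (Polynomial B)) ⊆ (H ∪ L0 : Set (Polynomial B)) := by
      intro g hg
      simp only [hG1, hH, Finset.coe_insert, Finset.coe_union, Set.mem_insert_iff, Set.mem_union,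
        Finset.mem_coe, Finset.mem_insert, Finset.mem_union] at hg ⊢
      tauto
    have hsub2 : (G ∪ (insert P L0 : Finset (Polynomial B)) : Set (Polynomial B)) ⊆
        insert P (G1 : Set (Polynomial B)) := by
      intro g hg
      simp only [hG1, Finset.coe_insert, Finset.coe_union, Set.mem_insert_iff, Set.mem_union,
        Finset.mem_coe] at hg ⊢
      tauto
    filter_upwards [ihL hL0 H hHd, hrem3, hp4, hlead, hc0] with ω ⟨S, hS⟩ hr hp4 hlead hc0
    obtain ⟨S1, hS1, hS1S⟩ := hS.drop hR₂ (pairs_mono φ ψ hsub1 ω)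
    have hsign : ∀ s ∈ S1.val, SignType.sign ((P.map φ).eval s.1) =
        SignType.sign ((P.map (ψ ω)).eval s.2) := by
      intro s hsS
      obtain ⟨_, ⟨h, hh, rfl⟩, t1, t2, t3, t4⟩ := hS1.1 s hsS
      obtain ⟨e1, e2⟩ := hr h hh s.1 s.2 t1 t3 t4
      rw [← e1, ← e2]
      exact hS.sign_self (hS1S hsS) ⟨rem h, by
        left
        simp only [hH, Finset.coe_insert, Finset.coe_union, Set.mem_insert_iff, Set.mem_union,
          Finset.mem_coe]
        right; right
        exact Finset.mem_image_of_mem _ hh, rfl⟩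
    have hfin : ∃ S2, Diag (insert (P.map φ, P.map (ψ ω)) (pairs φ ψ (G1 : Set (Polynomial B)) ω)) S2 := by
      rcases hp2 with hp2 | hp2
      · -- constant case
        have d1 : (P.map φ).derivative = 0 := by
          rw [Polynomial.derivative_map, ← hp3, hp2]; simp
        have d2 : (P.map (ψ ω)).derivative = 0 := by
          rw [Polynomial.derivative_map, ← hp4, hp2]; simp
        have c1 := Polynomial.eq_C_of_derivative_eq_zero d1
        have c2 := Polynomial.eq_C_of_derivative_eq_zero d2
        refine ⟨S1, ?_, ?_⟩
        · intro s hs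
          obtain ⟨t, ht, h'⟩ := hS1.1 s hs
          exact ⟨t, Set.mem_insert_of_mem _ ht, h'⟩
        · intro y y' hyy t ht
          rcases ht with rfl | ht
          · dsimp only
            rw [c1, c2]
            simp [hc0]
          · exact hS1.2 y y' hyy t ht
      · refine hS1.insert hR₁ hR₂ _ _ ⟨P.derivative, by simp [hG1], by
          simp [Polynomial.derivative_map]⟩ ?_ ?_ hsign
        · rw [Polynomial.derivative_map, ← hp3]
          intro h
          apply hp2
          rw [Polynomial.leadingCoeff, ← Polynomial.coeff_map, h, Polynomial.coeff_zero]
        · rw [Polynomial.derivative_map, ← hp4]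
          intro h
          have h1 : ψ ω P'.leadingCoeff = 0 := by
            rw [Polynomial.leadingCoeff, ← Polynomial.coeff_map, h, Polynomial.coeff_zero]
          rw [h1, sign_zero, eq_comm, sign_eq_zero_iff] at hlead
          exact hp2 hlead
    obtain ⟨S2, hS2⟩ := hfin
    obtain ⟨S3, hS3, -⟩ := hS2.drop hR₂ (T₀ := pairs φ ψ
      (G ∪ (insert P L0 : Finset (Polynomial B)) : Set (Polynomial B)) ω) (by
        refine (pairs_mono φ ψ hsub2 ω).trans ?_
        simp only [pairs, Set.image_insert_eq]
        exact subset_rfl)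
    exact ⟨S3, hS3⟩

lemma horm (hR₁ : IVP R₁) (hR₂ : IVP R₂)
    (hs : ∀ b, ∀ᶠ ω in F, SignType.sign (ψ ω b) = SignType.sign (φ b))
    (G : Finset (Polynomial B)) :
    ∀ᶠ ω in F, ∃ S, Diag (pairs φ ψ (G : Set (Polynomial B)) ω) S := by
  have main : ∀ d, ∀ G : Finset (Polynomial B), (∀ g ∈ G, g.natDegree ≤ d) →
      ∀ᶠ ω in F, ∃ S, Diag (pairs φ ψ (G : Set (Polynomial B)) ω) S := by
    intro d
    induction d with
    | zero => exact horm_base φ F ψ hs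
    | succ d ih =>
      intro G hG
      simpa using horm_step φ F ψ hR₁ hR₂ hs d ih G hG ∅ (by simp)
  exact main (G.sup Polynomial.natDegree) G fun g hg => Finset.le_sup (f := Polynomial.natDegree) hg
end Horm

lemma IVP_real : IVP ℝ := by
  intro p a b hab ha hb
  obtain ⟨c, hc, h⟩ := intermediate_value_Ioo hab.le (p.continuous.continuousOn) ⟨ha, hb⟩
  exact ⟨c, hc.1, hc.2, h⟩

lemma sign_hom_real {E : Type*} [Field E] [LinearOrder E] [IsStrictOrderedRing E] (φ : ℝ →+* E)
    (c : ℝ) : SignType.sign (φ c) = SignType.sign c := by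
  have hp : ∀ c : ℝ, 0 < c → 0 < φ c := fun c hc => by
    have h1 : φ c = φ (Real.sqrt c) ^ 2 := by rw [← map_pow, Real.sq_sqrt hc.le]
    rw [h1]
    have : φ (Real.sqrt c) ≠ 0 := by simpa using (Real.sqrt_pos.2 hc).ne'
    positivity
  rcases lt_trichotomy c 0 with h | h | h
  · have := hp (-c) (by linarith)
    rw [map_neg] at this
    rw [sign_neg h, sign_neg (by linarith)]
  · simp [h]
  · rw [sign_pos h, sign_pos (hp c h)]

lemma artin_lang_fin {E : Type*} [Field E] [LinearOrder E] [IsStrictOrderedRing E] (hE : IVP E)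
    (n : ℕ) : ∀ (φ : MvPolynomial (Fin n) ℝ →+* E) (G : Finset (MvPolynomial (Fin n) ℝ)),
    ∃ r : Fin n → ℝ, ∀ g ∈ G, SignType.sign (eval r g) = SignType.sign (φ g) := by
  classical
  induction n with
  | zero =>
    intro φ G
    refine ⟨Fin.elim0, fun g _ => ?_⟩
    rw [MvPolynomial.eq_C_of_isEmpty g, eval_C]
    exact (sign_hom_real (φ.comp C) _).symm
  | succ n ih =>
    intro φ G
    set φ' : MvPolynomial (Fin n) ℝ →+* E :=
      (φ.comp (finSuccEquiv ℝ n).symm.toRingEquiv.toRingHom).comp Polynomial.C with hφ'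
    have hφ : ∀ g, φ g = ((finSuccEquiv ℝ n g).map φ').eval (φ (X 0)) := by
      intro g
      obtain ⟨q, rfl⟩ := (finSuccEquiv ℝ n).symm.surjective g
      rw [AlgEquiv.apply_symm_apply]
      induction q using Polynomial.induction_on' with
      | add p q hp hq => simp [hp, hq]
      | monomial k a =>
        rw [← Polynomial.C_mul_X_pow_eq_monomial]
        simp only [map_mul, map_pow, Polynomial.map_mul, Polynomial.map_pow, Polynomial.map_C,
          Polynomial.map_X, Polynomial.eval_mul, Polynomial.eval_pow, Polynomial.eval_C,
          Polynomial.eval_X]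
        congr 2
        congr 1
        rw [AlgEquiv.symm_apply_eq, finSuccEquiv_X_zero]
    set F : Filter (Fin n → ℝ) := ⨅ g : MvPolynomial (Fin n) ℝ,
      Filter.principal {r | SignType.sign (eval r g) = SignType.sign (φ' g)} with hF
    have hne : F.NeBot := by
      rw [hF, (Filter.hasBasis_iInf_principal_finite _).neBot_iff]
      intro t ht
      obtain ⟨r, hr⟩ := ih φ' ht.toFinset
      refine ⟨r, ?_⟩
      simp only [Set.mem_iInter]
      exact fun g hg => hr g (by simpa using hg)
    have hs : ∀ b, ∀ᶠ r in F, SignType.sign (eval r b) = SignType.sign (φ' b) := fun b =>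
      Filter.mem_iInf_of_mem b (Filter.mem_principal_self _)
    obtain ⟨r, S, hS⟩ := (horm φ' F (fun r => eval r) hE IVP_real hs
      (G.image (finSuccEquiv ℝ n))).exists
    obtain ⟨y', hy'⟩ := exists_prel S (φ (X 0))
    refine ⟨Fin.cons y' r, fun g hg => ?_⟩
    rw [eval_eq_eval_mv_eval', hφ g]
    exact (hS.2 _ _ hy' _ ⟨finSuccEquiv ℝ n g, Finset.mem_coe.2 (Finset.mem_image_of_mem _ hg), rfl⟩).symm


/-! ### Preorderings and real closed points -/

/-- A preordering of a commutative ring, as a set. -/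
structure IsPre {A : Type*} [CommRing A] (T : Set A) : Prop where
  add : ∀ {a b}, a ∈ T → b ∈ T → a + b ∈ T
  mul : ∀ {a b}, a ∈ T → b ∈ T → a * b ∈ T
  sq : ∀ a, a ^ 2 ∈ T

section Pre
variable {A : Type*} [CommRing A]

lemma IsPre.one {T : Set A} (hT : IsPre T) : (1 : A) ∈ T := by simpa using hT.sq 1
lemma IsPre.zero {T : Set A} (hT : IsPre T) : (0 : A) ∈ T := by simpa using hT.sq 0

lemma IsPre.adjoin {T : Set A} (hT : IsPre T) (a : A) :
    IsPre {x | ∃ s ∈ T, ∃ t ∈ T, x = s + a * t} where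
  add := by
    rintro _ _ ⟨s, hs, t, ht, rfl⟩ ⟨u, hu, v, hv, rfl⟩
    exact ⟨s + u, hT.add hs hu, t + v, hT.add ht hv, by ring⟩
  mul := by
    rintro _ _ ⟨s, hs, t, ht, rfl⟩ ⟨u, hu, v, hv, rfl⟩
    exact ⟨s * u + a ^ 2 * (t * v), hT.add (hT.mul hs hu) (hT.mul (hT.sq a) (hT.mul ht hv)),
      s * v + t * u, hT.add (hT.mul hs hv) (hT.mul ht hu), by ring⟩
  sq := fun x => ⟨x ^ 2, hT.sq x, 0, hT.zero, by ring⟩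

lemma IsPre.exists_max {T : Set A} (hT : IsPre T) (h1 : (-1 : A) ∉ T) :
    ∃ P : Set A, T ⊆ P ∧ IsPre P ∧ (-1 : A) ∉ P ∧
      ∀ a, a ∉ P → ∃ s ∈ P, ∃ t ∈ P, -1 = s + a * t := by
  obtain ⟨P, hTP, hP⟩ := zorn_subset_nonempty {P : Set A | IsPre P ∧ (-1 : A) ∉ P} (by
    intro c hc hchain hne
    refine ⟨⋃₀ c, ⟨⟨?_, ?_, ?_⟩, ?_⟩, fun s hs => Set.subset_sUnion_of_mem hs⟩
    · rintro a b ⟨s, hs, ha⟩ ⟨t, ht, hb⟩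
      rcases hchain.total hs ht with h | h
      · exact ⟨t, ht, (hc ht).1.add (h ha) hb⟩
      · exact ⟨s, hs, (hc hs).1.add ha (h hb)⟩
    · rintro a b ⟨s, hs, ha⟩ ⟨t, ht, hb⟩
      rcases hchain.total hs ht with h | h
      · exact ⟨t, ht, (hc ht).1.mul (h ha) hb⟩
      · exact ⟨s, hs, (hc hs).1.mul ha (h hb)⟩
    · intro a
      obtain ⟨s, hs⟩ := hne
      exact ⟨s, hs, (hc hs).1.sq a⟩
    · rintro ⟨s, hs, h⟩
      exact (hc hs).2 h) T ⟨hT, h1⟩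
  refine ⟨P, hTP, hP.prop.1, hP.prop.2, fun a ha => ?_⟩
  by_contra hcon
  have h2 : ({x | ∃ s ∈ P, ∃ t ∈ P, x = s + a * t} : Set A) ⊆ P :=
    hP.le_of_ge (y := {x | ∃ s ∈ P, ∃ t ∈ P, x = s + a * t}) ⟨hP.prop.1.adjoin a, hcon⟩
      (fun x hx => ⟨x, hx, 0, hP.prop.1.zero, by ring⟩)
  exact ha (h2 ⟨0, hP.prop.1.zero, 1, hP.prop.1.one, by ring⟩)

/-- Maximal proper preorderings are orderings with prime support. -/
lemma IsPre.exists_ordering {T : Set A} (hT : IsPre T) (h1 : (-1 : A) ∉ T) :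
    ∃ P : Set A, T ⊆ P ∧ IsPre P ∧ (-1 : A) ∉ P ∧ (∃ I : Ideal A, I.IsPrime ∧
      ∀ a, a ∈ I ↔ a ∈ P ∧ -a ∈ P) := by
  obtain ⟨P, hTP, hP, hP1, hmax⟩ := hT.exists_max h1
  have htot : ∀ a, a ∈ P ∨ -a ∈ P := by
    intro a
    by_contra! h
    obtain ⟨s, hs, t, ht, e1⟩ := hmax _ h.1
    obtain ⟨u, hu, v, hv, e2⟩ := hmax _ h.2
    apply hP1
    have : (-1 : A) = s + u + s * u + a ^ 2 * (t * v) := by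
      linear_combination (1 + u) * e1 - a * t * e2
    rw [this]
    exact hP.add (hP.add (hP.add hs hu) (hP.mul hs hu)) (hP.mul (hP.sq a) (hP.mul ht hv))
  refine ⟨P, hTP, hP, hP1, ⟨⟨⟨{a | a ∈ P ∧ -a ∈ P}, ?_⟩, ?_⟩, ?_⟩, ⟨?_, ?_⟩, fun a => Iff.rfl⟩
  · rintro a b ⟨h1, h2⟩ ⟨h3, h4⟩
    exact ⟨hP.add h1 h3, by rw [neg_add]; exact hP.add h2 h4⟩
  · exact ⟨hP.zero, by simpa using hP.zero⟩
  · rintro c x ⟨h1, h2⟩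
    rcases htot c with h | h
    · exact ⟨hP.mul h h1, by simpa using hP.mul h h2⟩
    · exact ⟨by simpa using hP.mul h h2, by simpa using hP.mul h h1⟩
  · intro h
    have : (1 : A) ∈ P ∧ (-1 : A) ∈ P := by
      have h' := (Ideal.eq_top_iff_one _).1 h
      exact h'
    exact hP1 this.2
  · intro a b hab
    have aux : ∀ a b : A, -a ∉ P → -b ∉ P → -(a * b) ∈ P → False := by
      intro a b ha hb hab
      obtain ⟨s, hs, t, ht, e1⟩ := hmax _ ha
      obtain ⟨u, hu, v, hv, e2⟩ := hmax _ hb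
      have ha' : a ∈ P := (htot a).resolve_right ha
      have hb' : b ∈ P := (htot b).resolve_right hb
      apply hP1
      have : (-1 : A) = s + u + s * u + -(a * b) * (t * v) := by
        linear_combination (1 + u) * e1 + a * t * e2
      rw [this]
      exact hP.add (hP.add (hP.add hs hu) (hP.mul hs hu)) (hP.mul hab (hP.mul ht hv))
    change a * b ∈ P ∧ -(a * b) ∈ P at hab
    change (a ∈ P ∧ -a ∈ P) ∨ (b ∈ P ∧ -b ∈ P)
    by_contra! h
    obtain ⟨ha, hb⟩ := h
    by_cases ha' : -a ∈ P
    · have ha'' : a ∉ P := fun h => ha h ha'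
      by_cases hb' : -b ∈ P
      · have hb'' : b ∉ P := fun h => hb h hb'
        exact aux (-a) (-b) (by simpa using ha'') (by simpa using hb'') (by simpa using hab.2)
      · exact aux (-a) b (by simpa using ha'') hb' (by simpa using hab.1)
    · by_cases hb' : -b ∈ P
      · have hb'' : b ∉ P := fun h => hb h hb'
        exact aux a (-b) ha' (by simpa using hb'') (by simpa using hab.1)
      · exact aux a b ha' hb' hab.2

def sosSpan {Ω : Type*} [CommRing Ω] (P : Set A) (φ : A →+* Ω) (L : Set Ω) : AddSubmonoid Ω :=
  AddSubmonoid.closure {x | ∃ p ∈ P, ∃ e ∈ L, x = φ p * e ^ 2}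

lemma sosSpan_mul {Ω : Type*} [CommRing Ω] {P : Set A} (hP : IsPre P) (φ : A →+* Ω) {L : Set Ω}
    (hL : ∀ a ∈ L, ∀ b ∈ L, a * b ∈ L) {x y : Ω} (hx : x ∈ sosSpan P φ L)
    (hy : y ∈ sosSpan P φ L) : x * y ∈ sosSpan P φ L := by
  induction hx using AddSubmonoid.closure_induction with
  | zero => simp
  | add a b _ _ ha hb => rw [add_mul]; exact add_mem ha hb
  | mem x hx =>
    obtain ⟨p, hp, e, he, rfl⟩ := hx
    induction hy using AddSubmonoid.closure_induction with
    | zero => simp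
    | add a b _ _ ha hb => rw [mul_add]; exact add_mem ha hb
    | mem y hy =>
      obtain ⟨q, hq, e', he', rfl⟩ := hy
      exact AddSubmonoid.subset_closure ⟨p * q, hP.mul hp hq, e * e', hL _ he _ he', by
        rw [map_mul]; ring⟩

lemma sosSpan_frac {F : Type*} [Field F] {P : Set A} (hP : IsPre P) (φ : A →+* F)
    (hφ : ∀ x : F, ∃ a d : A, φ d ≠ 0 ∧ x * φ d = φ a)
    (hker : ∀ a, φ a = 0 → -a ∈ P) (hker' : ∀ a, a ∈ P → -a ∈ P → φ a = 0) :
    (-1 : F) ∉ sosSpan P φ Set.univ := by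
  have key : ∀ x ∈ sosSpan P φ (Set.univ : Set F), ∃ p ∈ P, ∃ d, φ d ≠ 0 ∧ φ p = φ d ^ 2 * x := by
    intro x hx
    induction hx using AddSubmonoid.closure_induction with
    | zero => exact ⟨0, hP.zero, 1, by simp, by simp⟩
    | add x y _ _ hx hy =>
      obtain ⟨p, hp, d, hd, e⟩ := hx
      obtain ⟨p', hp', d', hd', e'⟩ := hy
      refine ⟨p * d' ^ 2 + p' * d ^ 2, hP.add (hP.mul hp (hP.sq _)) (hP.mul hp' (hP.sq _)),
        d * d', by simp [hd, hd'], ?_⟩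
      simp only [map_add, map_mul, map_pow, e, e']
      ring
    | mem x hx =>
      obtain ⟨p, hp, e, he, rfl⟩ := hx
      obtain ⟨a, d, hd, h⟩ := hφ e
      refine ⟨p * a ^ 2, hP.mul hp (hP.sq _), d, hd, ?_⟩
      rw [map_mul, map_pow, ← h]; ring
  intro h
  obtain ⟨p, hp, d, hd, e⟩ := key _ h
  have h1 : φ (p + d ^ 2) = 0 := by rw [map_add, map_pow, e]; ring
  have h2 := hker _ h1
  have h3 : -(d ^ 2) ∈ P := by
    have := hP.add h2 hp
    convert this using 1; ring
  have h4 := hker' _ (hP.sq d) h3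
  rw [map_pow] at h4
  exact hd (pow_eq_zero_iff (two_ne_zero) |>.1 h4)

end Pre


section RealClosed
variable {A : Type*} [CommRing A] {E : Type*} [Field E] {Ω : Type*} [Field Ω] [Algebra E Ω]

lemma sq_or_neg_mem {P : Set A} (hP : IsPre P) (φ : A →+* E) [IsAlgClosed Ω]
    (h0 : (-1 : E) ∉ sosSpan P φ Set.univ)
    (hmax : ∀ θ : Ω, θ ∉ Set.range (algebraMap E Ω) →
      (-1 : Ω) ∈ sosSpan P ((algebraMap E Ω).comp φ) {x | ∃ q : Polynomial E, Polynomial.aeval θ q = x})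
    (a : E) : IsSquare a ∨ -a ∈ sosSpan P φ Set.univ := by
  by_cases hsq : IsSquare a
  · exact Or.inl hsq
  right
  obtain ⟨θ, hθ⟩ := IsAlgClosed.exists_pow_nat_eq (algebraMap E Ω a) (n := 2) (by norm_num)
  have hθE : θ ∉ Set.range (algebraMap E Ω) := by
    rintro ⟨b, rfl⟩
    apply hsq
    refine ⟨b, ?_⟩
    apply (algebraMap E Ω).injective
    rw [← hθ, map_mul, pow_two]
  have hlin : ∀ q : Polynomial E, ∃ u v : E, Polynomial.aeval θ q =
      algebraMap E Ω u + algebraMap E Ω v * θ := by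
    intro q
    induction q using Polynomial.induction_on' with
    | add p q hp hq =>
      obtain ⟨u, v, e⟩ := hp
      obtain ⟨u', v', e'⟩ := hq
      exact ⟨u + u', v + v', by rw [map_add, e, e', map_add, map_add]; ring⟩
    | monomial n c =>
      induction n with
      | zero => exact ⟨c, 0, by simp⟩
      | succ n ih =>
        obtain ⟨u, v, e⟩ := ih
        refine ⟨v * a, u, ?_⟩
        rw [Polynomial.aeval_monomial] at e ⊢
        rw [pow_succ, ← mul_assoc, e, map_mul, ← hθ]
        ring
  have hmul : ∀ {x y : E}, x ∈ sosSpan P φ Set.univ → y ∈ sosSpan P φ Set.univ →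
      x * y ∈ sosSpan P φ Set.univ := fun hx hy => sosSpan_mul hP φ (by simp) hx hy
  have key : ∀ x ∈ sosSpan P ((algebraMap E Ω).comp φ)
      {x | ∃ q : Polynomial E, Polynomial.aeval θ q = x},
      ∃ s ∈ sosSpan P φ (Set.univ : Set E), ∃ t ∈ sosSpan P φ (Set.univ : Set E), ∃ w : E,
      x = algebraMap E Ω (s + a * t) + algebraMap E Ω w * θ := by
    intro x hx
    induction hx using AddSubmonoid.closure_induction with
    | zero => exact ⟨0, zero_mem _, 0, zero_mem _, 0, by simp⟩
    | add x y _ _ hx hy =>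
      obtain ⟨s, hs, t, ht, w, e⟩ := hx
      obtain ⟨s', hs', t', ht', w', e'⟩ := hy
      refine ⟨s + s', add_mem hs hs', t + t', add_mem ht ht', w + w', ?_⟩
      rw [e, e']
      simp only [map_add, map_mul]
      ring
    | mem x hx =>
      obtain ⟨p, hp, e, ⟨q, rfl⟩, rfl⟩ := hx
      obtain ⟨u, v, e⟩ := hlin q
      refine ⟨φ p * u ^ 2, AddSubmonoid.subset_closure ⟨p, hp, u, trivial, rfl⟩,
        φ p * v ^ 2, AddSubmonoid.subset_closure ⟨p, hp, v, trivial, rfl⟩, 2 * φ p * u * v, ?_⟩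
      rw [e]
      simp only [map_add, map_mul, map_pow, RingHom.comp_apply, map_ofNat, ← hθ]
      ring
  obtain ⟨s, hs, t, ht, w, e⟩ := key _ (hmax θ hθE)
  have hw : w = 0 := by
    by_contra hw
    apply hθE
    refine ⟨(-1 - (s + a * t)) / w, ?_⟩
    have hw' : algebraMap E Ω w ≠ 0 := by simpa using hw
    rw [map_div₀, div_eq_iff hw', map_sub, map_neg, map_one]
    linear_combination e
  have e2 : (-1 : E) = s + a * t := by
    apply (algebraMap E Ω).injective
    rw [map_neg, map_one, e, hw]; simp
  have ht0 : t ≠ 0 := by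
    rintro rfl
    apply h0
    rw [e2]; simpa using hs
  have hsqm : ∀ x : E, x ^ 2 ∈ sosSpan P φ Set.univ := fun x =>
    AddSubmonoid.subset_closure ⟨1, hP.one, x, trivial, by simp⟩
  have : -a = (1 ^ 2 + s) * t * (1 / t) ^ 2 := by
    field_simp
    linear_combination e2
  rw [this]
  exact hmul (hmul (add_mem (hsqm 1) hs) ht) (hsqm _)

lemma sosSpan_isSquare {P : Set A} (hP : IsPre P) (φ : A →+* E) [IsAlgClosed Ω]
    (h0 : (-1 : E) ∉ sosSpan P φ Set.univ)
    (hmax : ∀ θ : Ω, θ ∉ Set.range (algebraMap E Ω) →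
      (-1 : Ω) ∈ sosSpan P ((algebraMap E Ω).comp φ) {x | ∃ q : Polynomial E, Polynomial.aeval θ q = x})
    (a : E) : a ∈ sosSpan P φ Set.univ ↔ IsSquare a := by
  constructor
  · intro ha
    rcases sq_or_neg_mem hP φ h0 hmax a with h | h
    · exact h
    · by_cases ha0 : a = 0
      · simp [ha0]
      exfalso
      apply h0
      have : (-1 : E) = a * (-a) * (1 / a) ^ 2 := by field_simp
      rw [this]
      exact sosSpan_mul hP φ (by simp) (sosSpan_mul hP φ (by simp) ha h)
        (AddSubmonoid.subset_closure ⟨1, hP.one, 1 / a, trivial, by simp⟩)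
  · rintro ⟨b, rfl⟩
    exact AddSubmonoid.subset_closure ⟨1, hP.one, b, trivial, by simp [pow_two]⟩

/-- The order in which the nonnegative elements are the squares. -/
lemma exists_order_of_squares (h1 : ∀ a : E, IsSquare a ∨ IsSquare (-a))
    (h2 : ∀ a b : E, IsSquare a → IsSquare b → IsSquare (a + b)) (h3 : ¬ IsSquare (-1 : E)) :
    ∃ (_ : LinearOrder E) (_ : IsStrictOrderedRing E), ∀ a : E, 0 ≤ a ↔ IsSquare a := by
  classical
  have hanti : ∀ a : E, IsSquare a → IsSquare (-a) → a = 0 := by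
    rintro a ⟨b, hb⟩ ⟨c, hc⟩
    by_contra ha
    apply h3
    have hb0 : b ≠ 0 := by rintro rfl; simp at hb; exact ha hb
    refine ⟨c / b, ?_⟩
    field_simp
    linear_combination hc + hb
  let o : LinearOrder E :=
    { le := fun a b => IsSquare (b - a)
      le_refl := fun a => by simp
      le_trans := fun a b c hab hbc => by
        have := h2 _ _ hab hbc
        simpa using this
      le_antisymm := fun a b hab hba => by
        have := hanti (b - a) hab (by simpa using hba)
        exact (sub_eq_zero.1 this).symm
      le_total := fun a b => by
        have := h1 (b - a)
        simpa using this
      toDecidableLE := fun _ _ => Classical.propDecidable _ }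
  have hle : ∀ a b : E, a ≤ b ↔ IsSquare (b - a) := fun a b => Iff.rfl
  have : IsOrderedRing E :=
    { add_le_add_left := fun a b h c => by
        rw [hle] at h ⊢; simpa using h
      zero_le_one := by rw [hle]; simp
      mul_le_mul_of_nonneg_left := fun a ha b c h => by
        simp only [hle, sub_zero] at *
        rw [← mul_sub]; exact ha.mul h
      mul_le_mul_of_nonneg_right := fun a ha b c h => by
        simp only [hle, sub_zero] at *
        rw [← sub_mul]; exact h.mul ha }
  refine ⟨o, IsOrderedRing.toIsStrictOrderedRing E, fun a => ?_⟩
  rw [hle]; simp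

lemma ivp_of_irreducible [LinearOrder E] [IsStrictOrderedRing E]
    (H : ∀ f : Polynomial E, Irreducible f → 2 ≤ f.natDegree →
      ∃ s ∈ AddSubmonoid.closure {x : Polynomial E | ∃ h : Polynomial E,
        h.natDegree < f.natDegree ∧ x = h ^ 2}, f ∣ 1 + s) : IVP E := by
  have main : ∀ d : ℕ, ∀ p : Polynomial E, p.natDegree = d → ∀ a b, a < b →
      p.eval a * p.eval b < 0 → ∃ c, a < c ∧ c < b ∧ p.eval c = 0 := by
    intro d
    induction d using Nat.strong_induction_on with
    | _ d ih =>
      intro p hp a b hab hneg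
      have hp0 : p ≠ 0 := by rintro rfl; simp at hneg
      have hd0 : p.natDegree ≠ 0 := by
        intro h
        rw [Polynomial.eq_C_of_natDegree_eq_zero h] at hneg
        simp only [Polynomial.eval_C] at hneg
        nlinarith [mul_self_nonneg (p.coeff 0)]
      by_cases hirr : Irreducible p
      · by_cases hd : 2 ≤ p.natDegree
        · obtain ⟨s, hs, k, hk⟩ := H p hirr hd
          have hs1 : ∀ c, 0 ≤ s.eval c := by
            intro c
            clear hk
            induction hs using AddSubmonoid.closure_induction with
            | zero => simp
            | add x y _ _ hx hy => rw [Polynomial.eval_add]; exact add_nonneg hx hy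
            | mem x hx =>
              obtain ⟨h, _, rfl⟩ := hx
              rw [Polynomial.eval_pow]; positivity
          have hs2 : s.natDegree ≤ 2 * (p.natDegree - 1) := by
            clear hk hs1
            induction hs using AddSubmonoid.closure_induction with
            | zero => simp
            | add x y _ _ hx hy => exact (Polynomial.natDegree_add_le _ _).trans (max_le hx hy)
            | mem x hx =>
              obtain ⟨h, h1, rfl⟩ := hx
              refine Polynomial.natDegree_pow_le.trans ?_
              omega
          have he : ∀ c, 1 + s.eval c = p.eval c * k.eval c := fun c => by
            have := congrArg (Polynomial.eval c) hk
            simpa using this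
          have hk0 : k ≠ 0 := by
            rintro rfl
            have := he a
            have := hs1 a
            simp at *
            linarith
          have hkd : k.natDegree < d := by
            have h1 : (1 + s).natDegree ≤ 2 * (p.natDegree - 1) :=
              (Polynomial.natDegree_add_le _ _).trans (max_le (by simp) hs2)
            rw [hk, Polynomial.natDegree_mul hp0 hk0] at h1
            omega
          have hkab : k.eval a * k.eval b < 0 := by
            have h1 := he a
            have h2 := he b
            have h3 := hs1 a
            have h4 := hs1 b
            have h5 : 0 < (p.eval a * k.eval a) * (p.eval b * k.eval b) := by
              rw [← h1, ← h2]; positivity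
            by_contra hcon
            push Not at hcon
            nlinarith [mul_nonneg hcon (neg_nonneg.2 hneg.le)]
          obtain ⟨c, _, _, h3⟩ := ih _ hkd k rfl a b hab hkab
          have h1 := he c
          have h2 := hs1 c
          rw [h3, mul_zero] at h1
          linarith
        · have hd1 : p.natDegree = 1 := by omega
          obtain ⟨u, hu, v, rfl⟩ := Polynomial.natDegree_eq_one.1 hd1
          simp only [Polynomial.eval_add, Polynomial.eval_mul, Polynomial.eval_C,
            Polynomial.eval_X] at hneg ⊢
          set c := -v / u with hc
          have hv : v = - c * u := by rw [hc]; field_simp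
          rw [hv] at hneg ⊢
          have h1 : u ^ 2 * ((a - c) * (b - c)) < 0 := by
            calc _ = _ := by ring
              _ < 0 := hneg
          have h2 : (a - c) * (b - c) < 0 := by
            have : 0 < u ^ 2 := by positivity
            by_contra hcon
            push Not at hcon
            nlinarith [mul_nonneg this.le hcon]
          refine ⟨c, ?_, ?_, by ring⟩
          · by_contra hcon
            push Not at hcon
            nlinarith
          · by_contra hcon
            push Not at hcon
            nlinarith
      · have hu : ¬ IsUnit p := fun h => hd0 (Polynomial.natDegree_eq_zero_of_isUnit h)
        rw [irreducible_iff] at hirr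
        push Not at hirr
        obtain ⟨q, r, rfl, hq, hr⟩ := hirr hu
        have hq0 : q ≠ 0 := left_ne_zero_of_mul hp0
        have hr0 : r ≠ 0 := right_ne_zero_of_mul hp0
        have hqd : 0 < q.natDegree := Polynomial.natDegree_pos_iff_degree_pos.2
          (Polynomial.degree_pos_of_ne_zero_of_nonunit hq0 hq)
        have hrd : 0 < r.natDegree := Polynomial.natDegree_pos_iff_degree_pos.2
          (Polynomial.degree_pos_of_ne_zero_of_nonunit hr0 hr)
        rw [Polynomial.natDegree_mul hq0 hr0] at hp
        simp only [Polynomial.eval_mul] at hneg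
        by_cases hqn : q.eval a * q.eval b < 0
        · obtain ⟨c, h1, h2, h3⟩ := ih _ (by omega) q rfl a b hab hqn
          exact ⟨c, h1, h2, by simp [h3]⟩
        · have hrn : r.eval a * r.eval b < 0 := by
            by_contra hcon
            push Not at hcon hqn
            nlinarith [mul_nonneg hcon hqn]
          obtain ⟨c, h1, h2, h3⟩ := ih _ (by omega) r rfl a b hab hrn
          exact ⟨c, h1, h2, by simp [h3]⟩
  intro p a b hab ha hb
  exact main _ p rfl a b hab (mul_neg_of_neg_of_pos ha hb)

lemma rcf_core {P : Set A} (hP : IsPre P) (φ : A →+* E) [IsAlgClosed Ω]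
    (h0 : (-1 : E) ∉ sosSpan P φ Set.univ)
    (hmax : ∀ θ : Ω, θ ∉ Set.range (algebraMap E Ω) →
      (-1 : Ω) ∈ sosSpan P ((algebraMap E Ω).comp φ) {x | ∃ q : Polynomial E, Polynomial.aeval θ q = x}) :
    ∃ (_ : LinearOrder E) (_ : IsStrictOrderedRing E), IVP E ∧ ∀ p ∈ P, 0 ≤ φ p := by
  have hsq := sosSpan_isSquare hP φ h0 hmax
  obtain ⟨o, io, ho⟩ := exists_order_of_squares (E := E)
    (fun a => by
      rcases sq_or_neg_mem hP φ h0 hmax a with h | h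
      · exact Or.inl h
      · exact Or.inr ((hsq _).1 h))
    (fun a b ha hb => by
      rw [← hsq] at *
      exact add_mem ha hb)
    (fun h => h0 ((hsq _).2 h))
  have hφ : ∀ p ∈ P, IsSquare (φ p) := fun p hp => (hsq _).1
    (AddSubmonoid.subset_closure ⟨p, hp, 1, trivial, by simp⟩)
  refine ⟨o, io, ivp_of_irreducible ?_, fun p hp => (ho _).2 (hφ p hp)⟩
  intro f hf hfd
  have hdeg : f.degree ≠ 0 := by
    intro h
    have := Polynomial.natDegree_eq_of_degree_eq_some (n := 0) h
    omega
  obtain ⟨θ, hθ⟩ := IsAlgClosed.exists_aeval_eq_zero Ω f hdeg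
  have hdvd : ∀ q : Polynomial E, Polynomial.aeval θ q = 0 → f ∣ q := by
    intro q hq
    have h1 : minpoly E θ ∣ f := minpoly.dvd E θ hθ
    have h2 : minpoly E θ ∣ q := minpoly.dvd E θ hq
    have h3 : Associated (minpoly E θ) f := by
      refine (hf.dvd_iff.1 h1).resolve_left ?_ |>.symm
      exact minpoly.not_isUnit E θ
    exact h3.symm.dvd.trans h2
  have hθE : θ ∉ Set.range (algebraMap E Ω) := by
    rintro ⟨b, rfl⟩
    have h1 := hdvd (Polynomial.X - Polynomial.C b) (by simp)
    have h2 := Polynomial.natDegree_le_of_dvd h1 (Polynomial.X_sub_C_ne_zero b)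
    rw [Polynomial.natDegree_X_sub_C] at h2
    omega
  have key : ∀ x ∈ sosSpan P ((algebraMap E Ω).comp φ)
      {x | ∃ q : Polynomial E, Polynomial.aeval θ q = x},
      ∃ s ∈ AddSubmonoid.closure {x : Polynomial E | ∃ h : Polynomial E,
        h.natDegree < f.natDegree ∧ x = h ^ 2}, Polynomial.aeval θ s = x := by
    intro x hx
    induction hx using AddSubmonoid.closure_induction with
    | zero => exact ⟨0, zero_mem _, by simp⟩
    | add x y _ _ hx hy =>
      obtain ⟨s, hs, rfl⟩ := hx
      obtain ⟨t, ht, rfl⟩ := hy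
      exact ⟨s + t, add_mem hs ht, by simp⟩
    | mem x hx =>
      obtain ⟨p, hp, _, ⟨q, rfl⟩, rfl⟩ := hx
      obtain ⟨u, hu⟩ := hφ p hp
      refine ⟨((Polynomial.C u * q) % f) ^ 2, AddSubmonoid.subset_closure
        ⟨_, Polynomial.natDegree_mod_lt _ (by omega), rfl⟩, ?_⟩
      have h1 := congrArg (Polynomial.aeval θ) (EuclideanDomain.div_add_mod (Polynomial.C u * q) f)
      rw [map_add, map_mul, hθ, zero_mul, zero_add] at h1
      rw [map_pow, h1, RingHom.comp_apply, hu]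
      simp
      ring
  obtain ⟨s, hs, hs1⟩ := key _ (hmax θ hθE)
  exact ⟨s, hs, hdvd _ (by simp [hs1])⟩

end RealClosed


lemma sosSpan_map {A E Ω : Type*} [CommRing A] [CommRing E] [CommRing Ω] (P : Set A) (φ : A →+* E)
    (χ : E →+* Ω) {L : Set E} {L' : Set Ω} (hL : ∀ x ∈ L, χ x ∈ L') {x : E}
    (hx : x ∈ sosSpan P φ L) : χ x ∈ sosSpan P (χ.comp φ) L' := by
  induction hx using AddSubmonoid.closure_induction with
  | zero => simp
  | add x y _ _ hx hy => rw [map_add]; exact add_mem hx hy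
  | mem x hx =>
    obtain ⟨p, hp, e, he, rfl⟩ := hx
    exact AddSubmonoid.subset_closure ⟨p, hp, χ e, hL _ he, by simp⟩

lemma sosSpan_mono {A Ω : Type*} [CommRing A] [CommRing Ω] (P : Set A) (φ : A →+* Ω)
    {L L' : Set Ω} (hL : L ⊆ L') : sosSpan P φ L ≤ sosSpan P φ L' :=
  AddSubmonoid.closure_mono (by
    rintro _ ⟨p, hp, e, he, rfl⟩
    exact ⟨p, hp, e, hL he, rfl⟩)

open IntermediateField in
lemma exists_max_field {A F Ω : Type*} [CommRing A] [Field F] [Field Ω] [Algebra F Ω]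
    [Algebra.IsAlgebraic F Ω] {P : Set A} (φ : A →+* F) (h0 : (-1 : F) ∉ sosSpan P φ Set.univ) :
    ∃ L : IntermediateField F Ω, (-1 : L) ∉ sosSpan P ((algebraMap F L).comp φ) Set.univ ∧
      ∀ θ : Ω, θ ∉ Set.range (algebraMap L Ω) →
      (-1 : Ω) ∈ sosSpan P ((algebraMap L Ω).comp ((algebraMap F L).comp φ))
        {x | ∃ q : Polynomial L, Polynomial.aeval θ q = x} := by
  set Φ : A →+* Ω := (algebraMap F Ω).comp φ with hΦ
  have hbot : (⊥ : IntermediateField F Ω) ∈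
      {L : IntermediateField F Ω | (-1 : Ω) ∉ sosSpan P Φ (L : Set Ω)} := by
    intro h
    have key : ∀ x ∈ sosSpan P Φ ((⊥ : IntermediateField F Ω) : Set Ω),
        ∃ y ∈ sosSpan P φ (Set.univ : Set F), algebraMap F Ω y = x := by
      intro x hx
      induction hx using AddSubmonoid.closure_induction with
      | zero => exact ⟨0, zero_mem _, by simp⟩
      | add x y _ _ hx hy =>
        obtain ⟨s, hs, rfl⟩ := hx
        obtain ⟨t, ht, rfl⟩ := hy
        exact ⟨s + t, add_mem hs ht, by simp⟩
      | mem x hx =>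
        obtain ⟨p, hp, e, he, rfl⟩ := hx
        obtain ⟨u, rfl⟩ := IntermediateField.mem_bot.1 he
        exact ⟨φ p * u ^ 2, AddSubmonoid.subset_closure ⟨p, hp, u, trivial, rfl⟩, by simp [hΦ]⟩
    obtain ⟨y, hy, e⟩ := key _ h
    have : y = -1 := by
      apply (algebraMap F Ω).injective
      simp [e]
    exact h0 (this ▸ hy)
  obtain ⟨L, -, hL⟩ := zorn_le_nonempty₀
    {L : IntermediateField F Ω | (-1 : Ω) ∉ sosSpan P Φ (L : Set Ω)} (by
      intro c hc hchain y hy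
      have : Nonempty c := ⟨⟨y, hy⟩⟩
      have hdir : Directed (· ≤ ·) (fun i : c => (i : IntermediateField F Ω)) :=
        hchain.directedOn.directed_val
      refine ⟨⨆ i : c, (i : IntermediateField F Ω), ?_, fun z hz =>
        le_iSup (fun i : c => (i : IntermediateField F Ω)) ⟨z, hz⟩⟩
      intro h
      have key : ∀ x ∈ sosSpan P Φ ((⨆ i : c, (i : IntermediateField F Ω) :
          IntermediateField F Ω) : Set Ω), ∃ i : c, x ∈ sosSpan P Φ (i : Set Ω) := by
        intro x hx
        induction hx using AddSubmonoid.closure_induction with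
        | zero => exact ⟨⟨y, hy⟩, zero_mem _⟩
        | add x y _ _ hx hy =>
          obtain ⟨i, hi⟩ := hx
          obtain ⟨j, hj⟩ := hy
          obtain ⟨k, hik, hjk⟩ := hdir i j
          exact ⟨k, add_mem (sosSpan_mono P Φ hik hi) (sosSpan_mono P Φ hjk hj)⟩
        | mem x hx =>
          obtain ⟨p, hp, e, he, rfl⟩ := hx
          rw [IntermediateField.coe_iSup_of_directed hdir, Set.mem_iUnion] at he
          obtain ⟨i, hi⟩ := he
          exact ⟨i, AddSubmonoid.subset_closure ⟨p, hp, e, hi, rfl⟩⟩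
      obtain ⟨i, hi⟩ := key _ h
      exact hc i.2 hi) ⊥ hbot
  have hcomp : (algebraMap L Ω).comp ((algebraMap F L).comp φ) = Φ := by
    rw [← RingHom.comp_assoc, ← IsScalarTower.algebraMap_eq]
  refine ⟨L, fun h => hL.prop ?_, fun θ hθ => ?_⟩
  · have := sosSpan_map P ((algebraMap F L).comp φ) (algebraMap L Ω) (L' := (L : Set Ω))
      (fun x _ => x.2) h
    rw [hcomp] at this
    simpa using this
  · rw [hcomp]
    by_contra hcon
    have halg : IsAlgebraic L θ := Algebra.IsAlgebraic.isAlgebraic θ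
    have hsub : ((L⟮θ⟯.restrictScalars F : IntermediateField F Ω) : Set Ω) ⊆
        {x | ∃ q : Polynomial L, Polynomial.aeval θ q = x} := by
      intro x hx
      have hx' : x ∈ L⟮θ⟯.toSubalgebra := hx
      rw [IntermediateField.adjoin_simple_toSubalgebra_of_isAlgebraic halg,
        Algebra.adjoin_singleton_eq_range_aeval] at hx'
      exact hx'
    have hle : L ≤ L⟮θ⟯.restrictScalars F := by
      intro x hx
      exact L⟮θ⟯.algebraMap_mem ⟨x, hx⟩
    have := hL.le_of_ge (y := L⟮θ⟯.restrictScalars F)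
      (fun h => hcon (sosSpan_mono P Φ hsub h)) hle
    exact hθ ⟨⟨θ, this (IntermediateField.mem_adjoin_simple_self L θ)⟩, rfl⟩

theorem exists_rcf_point {A : Type} [CommRing A] {T : Set A} (hT : IsPre T) (h1 : (-1 : A) ∉ T) :
    ∃ (E : Type) (_ : Field E) (_ : LinearOrder E) (_ : IsStrictOrderedRing E) (φ : A →+* E),
      IVP E ∧ ∀ t ∈ T, 0 ≤ φ t := by
  obtain ⟨P, hTP, hP, hP1, I, hI, hIP⟩ := hT.exists_ordering h1
  let F := FractionRing (A ⧸ I)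
  let φ : A →+* F := (algebraMap (A ⧸ I) F).comp (Ideal.Quotient.mk I)
  have hφ0 : ∀ a, φ a = 0 ↔ a ∈ I := by
    intro a
    simp only [φ, RingHom.comp_apply]
    rw [IsFractionRing.to_map_eq_zero_iff, Ideal.Quotient.eq_zero_iff_mem]
  have h0 : (-1 : F) ∉ sosSpan P φ Set.univ := by
    apply sosSpan_frac hP φ
    · intro x
      obtain ⟨a, d, hd, rfl⟩ := IsFractionRing.div_surjective (A := A ⧸ I) x
      obtain ⟨a, rfl⟩ := Ideal.Quotient.mk_surjective a
      obtain ⟨d, rfl⟩ := Ideal.Quotient.mk_surjective d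
      have hd' : φ d ≠ 0 := by
        have := IsFractionRing.to_map_ne_zero_of_mem_nonZeroDivisors (K := F) hd
        exact this
      exact ⟨a, d, hd', div_mul_cancel₀ _ hd'⟩
    · intro a ha
      exact ((hIP a).1 ((hφ0 a).1 ha)).2
    · intro a ha ha'
      exact (hφ0 a).2 ((hIP a).2 ⟨ha, ha'⟩)
  obtain ⟨L, hL0, hL⟩ := exists_max_field (Ω := AlgebraicClosure F) φ h0
  obtain ⟨o, io, hivp, hpos⟩ := rcf_core hP ((algebraMap F L).comp φ) hL0 hL
  exact ⟨L, inferInstance, o, io, _, hivp, fun t ht => hpos t (hTP ht)⟩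

/-- If `-1` is not in the preordering, then a finite part of it is satisfied at a real point. -/
theorem exists_real_point {n : ℕ} {T : Set (MvPolynomial (Fin n) ℝ)} (hT : IsPre T)
    (h1 : (-1 : MvPolynomial (Fin n) ℝ) ∉ T) (G : Finset (MvPolynomial (Fin n) ℝ))
    (hG : ∀ g ∈ G, g ∈ T) : ∃ r : Fin n → ℝ, ∀ g ∈ G, 0 ≤ eval r g := by
  obtain ⟨E, _, _, _, φ, hE, hφ⟩ := exists_rcf_point hT h1
  obtain ⟨r, hr⟩ := artin_lang_fin hE n φ G
  refine ⟨r, fun g hg => ?_⟩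
  have := hr g hg
  have h2 := hφ g (hG g hg)
  rw [← sign_nonneg_iff] at h2 ⊢
  rwa [this]

theorem exists_real_point' {ι : Type} [Fintype ι] {T : Set (MvPolynomial ι ℝ)} (hT : IsPre T)
    (h1 : (-1 : MvPolynomial ι ℝ) ∉ T) (G : Finset (MvPolynomial ι ℝ))
    (hG : ∀ g ∈ G, g ∈ T) : ∃ r : ι → ℝ, ∀ g ∈ G, 0 ≤ eval r g := by
  classical
  let e := Fintype.equivFin ι
  let ε := renameEquiv ℝ e
  obtain ⟨r, hr⟩ := exists_real_point (T := ε.symm ⁻¹' T)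
    ⟨fun ha hb => by simpa using hT.add ha hb, fun ha hb => by simpa using hT.mul ha hb,
      fun a => by simpa using hT.sq (ε.symm a)⟩ (by simpa using h1) (G.image ε) (by
      intro g hg
      obtain ⟨g', hg', rfl⟩ := Finset.mem_image.1 hg
      simpa using hG g' hg')
  refine ⟨r ∘ e, fun g hg => ?_⟩
  have := hr _ (Finset.mem_image_of_mem _ hg)
  simpa [ε, eval_rename] using this


/-! ### Archimedean quadratic modules -/

/-- A quadratic module of a polynomial ring, as a set. -/
structure IsQM {ι : Type*} (M : Set (MvPolynomial ι ℝ)) : Prop where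
  add : ∀ {a b}, a ∈ M → b ∈ M → a + b ∈ M
  sq_mul : ∀ (a) {b}, b ∈ M → a ^ 2 * b ∈ M
  one : (1 : MvPolynomial ι ℝ) ∈ M

/-- The archimedean property. -/
def Arch {ι : Type*} (M : Set (MvPolynomial ι ℝ)) : Prop :=
  ∀ a : MvPolynomial ι ℝ, ∃ k : ℝ, C k - a ∈ M

section QM
variable {ι : Type*} {M : Set (MvPolynomial ι ℝ)}

lemma IsQM.sq (hM : IsQM M) (a : MvPolynomial ι ℝ) : a ^ 2 ∈ M := by
  simpa using hM.sq_mul a hM.one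

lemma IsQM.zero (hM : IsQM M) : (0 : MvPolynomial ι ℝ) ∈ M := by simpa using hM.sq 0

lemma IsQM.C_mul (hM : IsQM M) {r : ℝ} (hr : 0 ≤ r) {a : MvPolynomial ι ℝ} (ha : a ∈ M) :
    C r * a ∈ M := by
  have := hM.sq_mul (C (Real.sqrt r)) ha
  rwa [← map_pow, Real.sq_sqrt hr] at this

lemma IsQM.C_mem (hM : IsQM M) {r : ℝ} (hr : 0 ≤ r) : C r ∈ M := by
  simpa using hM.C_mul hr hM.one

lemma IsQM.sumSq_mul (hM : IsQM M) {s a : MvPolynomial ι ℝ} (hs : IsSumSq s) (ha : a ∈ M) :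
    s * a ∈ M := by
  induction hs with
  | zero => simpa using hM.zero
  | sq_add b _ ih => rw [add_mul, ← pow_two]; exact hM.add (hM.sq_mul b ha) ih

lemma IsQM.sumSq (hM : IsQM M) {s : MvPolynomial ι ℝ} (hs : IsSumSq s) : s ∈ M := by
  simpa using hM.sumSq_mul hs hM.one

lemma IsQM.adjoin (hM : IsQM M) (a : MvPolynomial ι ℝ) :
    IsQM {x | ∃ m ∈ M, ∃ s, IsSumSq s ∧ x = m + s * a} where
  add := by
    rintro _ _ ⟨s, hs, t, ht, rfl⟩ ⟨u, hu, v, hv, rfl⟩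
    exact ⟨s + u, hM.add hs hu, t + v, ht.add hv, by ring⟩
  sq_mul := by
    rintro b _ ⟨s, hs, t, ht, rfl⟩
    exact ⟨b ^ 2 * s, hM.sq_mul b hs, b * b * t, (IsSumSq.mul_self b).mul ht, by ring⟩
  one := ⟨1, hM.one, 0, IsSumSq.zero, by ring⟩

lemma IsQM.neg_one_of_neg (hM : IsQM M) {r : ℝ} (hr : r < 0) (h : C r ∈ M) :
    (-1 : MvPolynomial ι ℝ) ∈ M := by
  have := hM.C_mul (r := -1 / r) (by rw [neg_div]; exact (neg_pos.2 (one_div_neg.2 hr)).le) h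
  rw [← map_mul, div_mul_cancel₀ _ hr.ne] at this
  simpa using this

/-- Multiplication by an arbitrary element preserves the support. -/
lemma diff_sq (c : MvPolynomial ι ℝ) : c = (C (1 / 2) * (c + 1)) ^ 2 - (C (1 / 2) * (c - 1)) ^ 2 := by
  have h : (C (1 / 2) : MvPolynomial ι ℝ) * C (1 / 2) * 4 = 1 := by
    rw [← map_mul, show (4 : MvPolynomial ι ℝ) = C 4 from rfl, ← map_mul]; norm_num
  linear_combination -c * h

lemma IsQM.supp_mul (hM : IsQM M) {x : MvPolynomial ι ℝ} (h1 : x ∈ M) (h2 : -x ∈ M)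
    (c : MvPolynomial ι ℝ) : c * x ∈ M := by
  rw [diff_sq c]
  have := hM.add (hM.sq_mul (C (1 / 2) * (c + 1)) h1) (hM.sq_mul (C (1 / 2) * (c - 1)) h2)
  convert this using 1
  ring

lemma IsQM.exists_max (hM : IsQM M) (h1 : (-1 : MvPolynomial ι ℝ) ∉ M) :
    ∃ Q : Set (MvPolynomial ι ℝ), M ⊆ Q ∧ IsQM Q ∧ (-1 : MvPolynomial ι ℝ) ∉ Q ∧
      ∀ a, a ∈ Q ∨ -a ∈ Q := by
  obtain ⟨P, hTP, hP⟩ := zorn_subset_nonempty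
    {P : Set (MvPolynomial ι ℝ) | IsQM P ∧ (-1 : MvPolynomial ι ℝ) ∉ P} (by
    intro c hc hchain hne
    refine ⟨⋃₀ c, ⟨⟨?_, ?_, ?_⟩, ?_⟩, fun s hs => Set.subset_sUnion_of_mem hs⟩
    · rintro a b ⟨s, hs, ha⟩ ⟨t, ht, hb⟩
      rcases hchain.total hs ht with h | h
      · exact ⟨t, ht, (hc ht).1.add (h ha) hb⟩
      · exact ⟨s, hs, (hc hs).1.add ha (h hb)⟩
    · rintro a b ⟨t, ht, hb⟩
      exact ⟨t, ht, (hc ht).1.sq_mul a hb⟩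
    · obtain ⟨s, hs⟩ := hne
      exact ⟨s, hs, (hc hs).1.one⟩
    · rintro ⟨s, hs, h⟩
      exact (hc hs).2 h) M ⟨hM, h1⟩
  have hQ := hP.prop.1
  have hmax : ∀ a, a ∉ P → ∃ q ∈ P, ∃ s, IsSumSq s ∧ -1 = q + s * a := by
    intro a ha
    by_contra hcon
    have h2 : ({x | ∃ m ∈ P, ∃ s, IsSumSq s ∧ x = m + s * a} : Set (MvPolynomial ι ℝ)) ⊆ P :=
      hP.le_of_ge (y := {x | ∃ m ∈ P, ∃ s, IsSumSq s ∧ x = m + s * a}) ⟨hQ.adjoin a, hcon⟩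
        (fun x hx => ⟨x, hx, 0, IsSumSq.zero, by ring⟩)
    exact ha (h2 ⟨0, hQ.zero, 1, by simp, by ring⟩)
  refine ⟨P, hTP, hQ, hP.prop.2, fun a => ?_⟩
  by_contra! h
  obtain ⟨q1, hq1, s1, hs1, e1⟩ := hmax _ h.1
  obtain ⟨q2, hq2, s2, hs2, e2⟩ := hmax _ h.2
  apply hP.prop.2
  have hneg : -s1 ∈ P := by
    have : -s1 = s2 + s2 * q1 + s1 * q2 := by
      linear_combination s2 * e1 + s1 * e2
    rw [this]
    exact hQ.add (hQ.add (hQ.sumSq hs2) (hQ.sumSq_mul hs2 hq1)) (hQ.sumSq_mul hs1 hq2)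
  rw [e1, mul_comm]
  exact hQ.add hq1 (hQ.supp_mul (hQ.sumSq hs1) hneg a)

/-- Elements bounded by constants modulo the module. -/
def Bdd (M : Set (MvPolynomial ι ℝ)) (a : MvPolynomial ι ℝ) : Prop :=
  ∃ k : ℝ, C k - a ∈ M ∧ C k + a ∈ M

lemma Bdd.add (hM : IsQM M) {a b : MvPolynomial ι ℝ} (ha : Bdd M a) (hb : Bdd M b) :
    Bdd M (a + b) := by
  obtain ⟨k, h1, h2⟩ := ha
  obtain ⟨l, h3, h4⟩ := hb
  refine ⟨k + l, ?_, ?_⟩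
  · convert hM.add h1 h3 using 1; rw [map_add]; ring
  · convert hM.add h2 h4 using 1; rw [map_add]; ring

lemma Bdd.neg {a : MvPolynomial ι ℝ} (ha : Bdd M a) : Bdd M (-a) := by
  obtain ⟨k, h1, h2⟩ := ha
  exact ⟨k, by simpa using h2, by simpa [sub_eq_add_neg] using h1⟩

lemma Bdd.C_mul_nonneg (hM : IsQM M) {a : MvPolynomial ι ℝ} (ha : Bdd M a) {r : ℝ} (hr : 0 ≤ r) :
    Bdd M (C r * a) := by
  obtain ⟨k, h1, h2⟩ := ha
  refine ⟨r * k, ?_, ?_⟩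
  · convert hM.C_mul hr h1 using 1; rw [map_mul]; ring
  · convert hM.C_mul hr h2 using 1; rw [map_mul]; ring

lemma Bdd.sq (hM : IsQM M) {a : MvPolynomial ι ℝ} (ha : Bdd M a) : Bdd M (a ^ 2) := by
  obtain ⟨k', h1', h2'⟩ := ha
  obtain ⟨k, hk, h1, h2⟩ : ∃ k : ℝ, 0 < k ∧ C k - a ∈ M ∧ C k + a ∈ M := by
    refine ⟨|k'| + 1, by positivity, ?_, ?_⟩
    · have := hM.add h1' (hM.C_mem (r := |k'| + 1 - k') (by linarith [le_abs_self k']))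
      convert this using 1; rw [map_sub]; ring
    · have := hM.add h2' (hM.C_mem (r := |k'| + 1 - k') (by linarith [le_abs_self k']))
      convert this using 1; rw [map_sub]; ring
  refine ⟨k ^ 2, ?_, hM.add (hM.C_mem (by positivity)) (hM.sq a)⟩
  have h3 := hM.C_mul (r := 1 / (2 * k)) (by positivity)
    (hM.add (hM.sq_mul (C k - a) h2) (hM.sq_mul (C k + a) h1))
  convert h3 using 1
  have h4 : (C (1 / (2 * k)) : MvPolynomial ι ℝ) * C k * 2 = 1 := by
    rw [show (2 : MvPolynomial ι ℝ) = C 2 from rfl, ← map_mul, ← map_mul, ← map_one C]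
    congr 1; field_simp
  rw [map_pow]
  linear_combination -(C k ^ 2 - a ^ 2) * h4

lemma Bdd.mul (hM : IsQM M) {a b : MvPolynomial ι ℝ} (ha : Bdd M a) (hb : Bdd M b) :
    Bdd M (a * b) := by
  have h1 := (ha.add hM hb).sq hM
  have h2 := ((ha.add hM hb.neg).sq hM).neg
  have h3 := (h1.add hM h2).C_mul_nonneg hM (r := 1 / 4) (by norm_num)
  convert h3 using 1
  have h4 : (C (1 / 4) : MvPolynomial ι ℝ) * 4 = 1 := by
    rw [show (4 : MvPolynomial ι ℝ) = C 4 from rfl, ← map_mul, ← map_one C]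
    congr 1; norm_num
  linear_combination -(a * b) * h4

lemma IsQM.arch_of_ball [Fintype ι] (hM : IsQM M) (N : ℝ)
    (hN : C N - ∑ i, (X i : MvPolynomial ι ℝ) ^ 2 ∈ M) : Arch M := by
  classical
  have hsum : ∀ s : Finset ι, ∑ i ∈ s, (X i : MvPolynomial ι ℝ) ^ 2 ∈ M := by
    intro s
    induction s using Finset.induction_on with
    | empty => simpa using hM.zero
    | insert a s ha ih => rw [Finset.sum_insert ha]; exact hM.add (hM.sq _) ih
  have hX : ∀ i, Bdd M (X i) := by
    intro i
    have h1 : C N - X i ^ 2 ∈ M := by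
      have := hM.add hN (hsum (Finset.univ.erase i))
      rw [← Finset.add_sum_erase _ _ (Finset.mem_univ i)] at this
      convert this using 1; ring
    have hc : (C ((N + 1) / 2) : MvPolynomial ι ℝ) = C (1 / 2) * (C N + 1) := by
      rw [← map_one C, ← map_add, ← map_mul]; congr 1; ring
    have hc' : (C (1 / 2) : MvPolynomial ι ℝ) * 2 = 1 := by
      rw [show (2 : MvPolynomial ι ℝ) = C 2 from rfl, ← map_mul, ← map_one C]
      congr 1; norm_num
    refine ⟨(N + 1) / 2, ?_, ?_⟩
    · have := hM.C_mul (r := 1 / 2) (by norm_num) (hM.add h1 (hM.sq (1 - X i)))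
      convert this using 1
      rw [hc]
      linear_combination X i * hc'
    · have := hM.C_mul (r := 1 / 2) (by norm_num) (hM.add h1 (hM.sq (1 + X i)))
      convert this using 1
      rw [hc]
      linear_combination -X i * hc'
  intro a
  have : Bdd M a := by
    induction a using MvPolynomial.induction_on with
    | C r =>
      refine ⟨|r|, ?_, ?_⟩
      · rw [← map_sub]; exact hM.C_mem (by linarith [le_abs_self r])
      · rw [← map_add]; exact hM.C_mem (by linarith [neg_abs_le r])
    | add p q hp hq => exact hp.add hM hq
    | mul_X p i hp => exact hp.mul hM (hX i)
  obtain ⟨k, h, _⟩ := this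
  exact ⟨k, h⟩

/-- A proper archimedean quadratic module has a real point. -/
theorem IsQM.exists_point (hM : IsQM M) (hA : Arch M) (h1 : (-1 : MvPolynomial ι ℝ) ∉ M) :
    ∃ c : ι → ℝ, ∀ q ∈ M, 0 ≤ eval c q := by
  obtain ⟨Q, hMQ, hQ, hQ1, htot⟩ := hM.exists_max h1
  have hcst : ∀ r : ℝ, C r ∈ Q → 0 ≤ r := by
    intro r hr
    by_contra hcon
    exact hQ1 (hQ.neg_one_of_neg (not_le.1 hcon) hr)
  have hbd : ∀ i, BddAbove {r : ℝ | (X i : MvPolynomial ι ℝ) - C r ∈ Q} := by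
    intro i
    obtain ⟨k, hk⟩ := hA (X i)
    refine ⟨k, fun r hr => ?_⟩
    have := hQ.add (hMQ hk) hr
    have := hcst (k - r) (by convert this using 1; rw [map_sub]; ring)
    linarith
  have hne : ∀ i, {r : ℝ | (X i : MvPolynomial ι ℝ) - C r ∈ Q}.Nonempty := by
    intro i
    obtain ⟨k, hk⟩ := hA (-X i)
    refine ⟨-k, ?_⟩
    have := hMQ hk
    simp only [Set.mem_setOf_eq, map_neg]
    convert this using 1; ring
  set c : ι → ℝ := fun i => sSup {r : ℝ | (X i : MvPolynomial ι ℝ) - C r ∈ Q} with hc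
  set J : Set (MvPolynomial ι ℝ) := {a | ∀ ε : ℝ, 0 < ε → C ε - a ∈ Q ∧ C ε + a ∈ Q} with hJ
  have hJadd : ∀ {a b}, a ∈ J → b ∈ J → a + b ∈ J := by
    intro a b ha hb ε hε
    obtain ⟨h1, h2⟩ := ha (ε / 2) (by positivity)
    obtain ⟨h3, h4⟩ := hb (ε / 2) (by positivity)
    have e : (C ε : MvPolynomial ι ℝ) = C (ε / 2) + C (ε / 2) := by
      rw [← map_add]; congr 1; ring
    constructor
    · convert hQ.add h1 h3 using 1; rw [e]; ring
    · convert hQ.add h2 h4 using 1; rw [e]; ring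
  have hJneg : ∀ {a}, a ∈ J → -a ∈ J := by
    intro a ha ε hε
    obtain ⟨h1, h2⟩ := ha ε hε
    exact ⟨by simpa using h2, by simpa [sub_eq_add_neg] using h1⟩
  have hJsq : ∀ {a} (b), a ∈ J → b ^ 2 * a ∈ J := by
    intro a b ha ε hε
    obtain ⟨k', hk'⟩ := hA (b ^ 2)
    obtain ⟨k, hk0, hk⟩ : ∃ k : ℝ, 0 < k ∧ C k - b ^ 2 ∈ Q := by
      refine ⟨|k'| + 1, by positivity, ?_⟩
      have := hQ.add (hMQ hk') (hQ.C_mem (r := |k'| + 1 - k') (by linarith [le_abs_self k']))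
      convert this using 1; rw [map_sub]; ring
    obtain ⟨h1, h2⟩ := ha (ε / k) (by positivity)
    have h3 := hQ.C_mul (r := ε / k) (by positivity) hk
    have e : (C ε : MvPolynomial ι ℝ) = C (ε / k) * C k := by
      rw [← map_mul]; congr 1; field_simp
    constructor
    · convert hQ.add (hQ.sq_mul b h1) h3 using 1; rw [e]; ring
    · convert hQ.add (hQ.sq_mul b h2) h3 using 1; rw [e]; ring
  have hJmul : ∀ {a} (b), a ∈ J → b * a ∈ J := by
    intro a b ha
    rw [diff_sq b, sub_mul, sub_eq_add_neg]
    exact hJadd (hJsq _ ha) (hJneg (hJsq _ ha))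
  have hJX : ∀ i, X i - C (c i) ∈ J := by
    intro i ε hε
    constructor
    · rcases htot (X i - C (c i + ε)) with h | h
      · have := le_csSup (hbd i) h
        simp only [hc] at this
        linarith
      · convert h using 1; rw [map_add]; ring
    · obtain ⟨r, hr, hr2⟩ := exists_lt_of_lt_csSup (hne i) (show c i - ε < c i by linarith)
      have := hQ.add hr (hQ.C_mem (r := r - (c i - ε)) (by linarith))
      convert this using 1; simp only [map_sub]; ring
  have hJall : ∀ a, a - C (eval c a) ∈ J := by
    intro a
    induction a using MvPolynomial.induction_on with
    | C r =>
      intro ε hε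
      simpa using hQ.C_mem hε.le
    | add p q hp hq =>
      convert hJadd hp hq using 1
      rw [map_add, map_add]; ring
    | mul_X p i hp =>
      convert hJadd (hJmul (X i) hp) (hJmul (C (eval c p)) (hJX i)) using 1
      rw [map_mul, map_mul, eval_X]; ring
  refine ⟨c, fun q hq => ?_⟩
  by_contra hcon
  push Not at hcon
  obtain ⟨h1, -⟩ := hJall q (-(eval c q) / 2) (by linarith)
  have := hQ.add (hMQ hq) h1
  have := hcst (eval c q / 2) (by
    convert this using 1
    rw [show (eval c q) / 2 = -(eval c q) / 2 + eval c q by ring, map_add]; ring)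
  linarith

/-- The representation theorem for archimedean quadratic modules. -/
theorem IsQM.mem_of_pos (hM : IsQM M) (hA : Arch M) (f : MvPolynomial ι ℝ)
    (hf : ∀ c : ι → ℝ, (∀ q ∈ M, 0 ≤ eval c q) → 0 < eval c f) : f ∈ M := by
  have hneg : (-1 : MvPolynomial ι ℝ) ∈ {x | ∃ m ∈ M, ∃ s, IsSumSq s ∧ x = m + s * (-f)} := by
    by_contra hcon
    have hA' : Arch {x | ∃ m ∈ M, ∃ s, IsSumSq s ∧ x = m + s * (-f)} := fun a => by
      obtain ⟨k, hk⟩ := hA a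
      exact ⟨k, _, hk, 0, IsSumSq.zero, by ring⟩
    obtain ⟨c, hc⟩ := (hM.adjoin (-f)).exists_point hA' hcon
    have h1 := hf c fun q hq => hc q ⟨q, hq, 0, IsSumSq.zero, by ring⟩
    have h2 := hc (-f) ⟨0, hM.zero, 1, by simp, by ring⟩
    rw [map_neg] at h2
    linarith
  obtain ⟨m, hm, t, ht, e⟩ := hneg
  have hm' : t * f - 1 ∈ M := by
    convert hm using 1; linear_combination e
  obtain ⟨k1, hk1⟩ := hA t
  obtain ⟨k2, hk2⟩ := hA (1 + t ^ 2 * f)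
  obtain ⟨k, hk0, hk3, hk4⟩ : ∃ k : ℝ, 0 < k ∧ 2 * C k - t ∈ M ∧
      2 * C k - 1 - t ^ 2 * f ∈ M := by
    refine ⟨|k1| + |k2| + 1, by positivity, ?_, ?_⟩
    · have := hM.add hk1 (hM.C_mem (r := 2 * (|k1| + |k2| + 1) - k1)
        (by linarith [le_abs_self k1, abs_nonneg k2, abs_nonneg k1]))
      convert this using 1
      rw [map_sub, map_mul, map_ofNat]; ring
    · have := hM.add hk2 (hM.C_mem (r := 2 * (|k1| + |k2| + 1) - k2)
        (by linarith [le_abs_self k2, abs_nonneg k2, abs_nonneg k1]))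
      convert this using 1
      rw [map_sub, map_mul, map_ofNat]; ring
  have ht2 : t * (2 * C k - t) ∈ M := hM.sumSq_mul ht hk3
  have step : ∀ r : ℝ, 0 ≤ r → f + C r ∈ M → f + C (r - 1 / k ^ 2) ∈ M := by
    intro r hr h
    have h1 := hM.add (hM.add (hM.add (hM.sq_mul (C k - t) h) (hM.C_mul (r := 2 * k)
      (by positivity) hm')) (hM.C_mul hr ht2)) hk4
    have h2 := hM.C_mul (r := 1 / k ^ 2) (by positivity) h1
    convert h2 using 1
    have h4 : (C (1 / k ^ 2) : MvPolynomial ι ℝ) * C k ^ 2 = 1 := by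
      rw [← map_pow, ← map_mul, ← map_one C]
      congr 1; field_simp
    rw [map_sub, map_mul, map_ofNat]
    linear_combination (-f - C r) * h4
  obtain ⟨r0, hr0⟩ := hA (-f)
  have hiter : ∀ n : ℕ, f + C (max (r0 - n / k ^ 2) 0) ∈ M := by
    intro n
    induction n with
    | zero =>
      have := hM.add hr0 (hM.C_mem (r := max (r0 - ((0 : ℕ) : ℝ) / k ^ 2) 0 - r0) (by
        have := le_max_left (r0 - ((0 : ℕ) : ℝ) / k ^ 2) 0
        simp at this ⊢))
      convert this using 1; rw [map_sub]; ring
    | succ n ih =>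
      have h1 := step _ (le_max_right _ _) ih
      have := hM.add h1 (hM.C_mem (r := max (r0 - ((n + 1 : ℕ) : ℝ) / k ^ 2) 0 -
        (max (r0 - n / k ^ 2) 0 - 1 / k ^ 2)) (by
          have h2 : 0 < 1 / k ^ 2 := by positivity
          have h3 : ((n + 1 : ℕ) : ℝ) / k ^ 2 = n / k ^ 2 + 1 / k ^ 2 := by
            push_cast; ring
          rw [h3]
          rcases max_cases (r0 - n / k ^ 2) 0 with ⟨h, _⟩ | ⟨h, _⟩
          · rw [h]
            linarith [le_max_left (r0 - (n / k ^ 2 + 1 / k ^ 2)) 0]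
          · rw [h]
            linarith [le_max_right (r0 - (n / k ^ 2 + 1 / k ^ 2)) 0]))
      convert this using 1; simp only [map_sub]; ring
  obtain ⟨n, hn⟩ := exists_nat_ge (r0 * k ^ 2)
  have h := hiter n
  have h5 : r0 - n / k ^ 2 ≤ 0 := by
    rw [sub_nonpos, le_div_iff₀ (by positivity)]; exact hn
  rw [max_eq_right h5] at h
  simpa using h

lemma IsPre.isQM {T : Set (MvPolynomial ι ℝ)} (hT : IsPre T) : IsQM T :=
  ⟨hT.add, fun a _ hb => hT.mul (hT.sq a) hb, hT.one⟩

end QM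


/-- Wörmann's trick: the preordering of a compact set is archimedean. -/
theorem IsPre.arch {ι : Type} [Fintype ι] {T : Set (MvPolynomial ι ℝ)} (hT : IsPre T)
    (G : Finset (MvPolynomial ι ℝ)) (hG : ∀ g ∈ G, g ∈ T) (N₀ : ℝ)
    (hN : ∀ r : ι → ℝ, (∀ g ∈ G, 0 ≤ eval r g) → ∑ i, r i ^ 2 < N₀) : Arch T := by
  classical
  obtain ⟨N, hN0, hN⟩ : ∃ N : ℝ, 0 ≤ N ∧
      ∀ r : ι → ℝ, (∀ g ∈ G, 0 ≤ eval r g) → ∑ i, r i ^ 2 < N :=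
    ⟨max N₀ 0, le_max_right _ _, fun r hr => (hN r hr).trans_le (le_max_left _ _)⟩
  set S : MvPolynomial ι ℝ := ∑ i, X i ^ 2 with hS
  have hQ := hT.isQM
  have hST : S ∈ T := by
    have : ∀ s : Finset ι, ∑ i ∈ s, (X i : MvPolynomial ι ℝ) ^ 2 ∈ T := by
      intro s
      induction s using Finset.induction_on with
      | empty => simpa using hT.zero
      | insert a s ha ih => rw [Finset.sum_insert ha]; exact hT.add (hT.sq _) ih
    exact this _
  have hneg : (-1 : MvPolynomial ι ℝ) ∈ {x | ∃ s ∈ T, ∃ t ∈ T, x = s + (S - C N) * t} := by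
    by_contra hcon
    obtain ⟨r, hr⟩ := exists_real_point' (hT.adjoin (S - C N)) hcon (insert (S - C N) G) (by
      intro g hg
      rcases Finset.mem_insert.1 hg with rfl | hg
      · exact ⟨0, hT.zero, 1, hT.one, by ring⟩
      · exact ⟨g, hG g hg, 0, hT.zero, by ring⟩)
    have h1 := hr (S - C N) (by simp)
    have h2 := hN r fun g hg => hr g (by simp [hg])
    rw [hS] at h1
    simp at h1
    linarith
  obtain ⟨t0, ht0, t1, ht1, e⟩ := hneg
  obtain ⟨M, s1, hs1, s2, hs2, e2⟩ := (hT.adjoin (C N - S)).isQM.arch_of_ball N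
    ⟨0, hT.zero, 1, hT.one, by ring⟩ t0
  have h1 : (1 + t0) * (C N - S) ∈ T := by
    have : (1 + t0) * (C N - S) = t1 * (C N - S) ^ 2 := by linear_combination -(C N - S) * e
    rw [this]; exact hT.mul ht1 (hT.sq _)
  have h2 : (1 + t0) * (C M - t0) ∈ T := by
    have : (1 + t0) * (C M - t0) = (1 + t0) * s1 + (1 + t0) * (C N - S) * s2 := by
      rw [e2]; ring
    rw [this]
    exact hT.add (hT.mul (hT.add hT.one ht0) hs1) (hT.mul h1 hs2)
  have h3 : C (M + M ^ 2 / 4) - t0 ∈ T := by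
    have := hT.add h2 (hT.sq (t0 - C (M / 2)))
    convert this using 1
    have e3 : (C M : MvPolynomial ι ℝ) = C (M / 2) + C (M / 2) := by
      rw [← map_add]; congr 1; ring
    have e4 : (C (M + M ^ 2 / 4) : MvPolynomial ι ℝ) = C (M / 2) + C (M / 2) + C (M / 2) ^ 2 := by
      rw [← map_pow, ← map_add, ← map_add]; congr 1; ring
    rw [e3, e4]; ring
  have h4 := hT.add (hT.add h1 (hT.mul hST ht0)) (hQ.C_mul hN0 h3)
  refine hQ.arch_of_ball (N + N * (M + M ^ 2 / 4)) ?_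
  convert h4 using 1
  rw [map_add, map_mul]; ring

lemma isSOS_iff {ι : Type*} (q : MvPolynomial ι ℝ) : IsSOS q ↔ IsSumSq q := by
  constructor
  · rintro ⟨k, s, rfl⟩
    exact IsSumSq.sum fun i _ => by rw [pow_two]; exact IsSumSq.mul_self _
  · intro h
    induction h with
    | zero => exact ⟨0, Fin.elim0, by simp⟩
    | sq_add a _ ih =>
      obtain ⟨k, s, rfl⟩ := ih
      exact ⟨k + 1, Fin.cons a s, by simp [Fin.sum_univ_succ, pow_two]⟩

section Link
variable {ι κ : Type*} [Fintype κ] [DecidableEq κ] (g : κ → MvPolynomial ι ℝ)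

lemma inPre_add {a b : MvPolynomial ι ℝ} (ha : InPreordering g a) (hb : InPreordering g b) :
    InPreordering g (a + b) := by
  obtain ⟨c, hc, rfl⟩ := ha
  obtain ⟨d, hd, rfl⟩ := hb
  refine ⟨c + d, fun J => ?_, ?_⟩
  · have h1 := (isSOS_iff _).1 (hc J)
    have h2 := (isSOS_iff _).1 (hd J)
    exact (isSOS_iff _).2 (h1.add h2)
  · rw [← Finset.sum_add_distrib]
    exact Finset.sum_congr rfl fun J _ => by simp [add_mul]

lemma inPre_gen {s : MvPolynomial ι ℝ} (hs : IsSumSq s) (J : Finset κ) :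
    InPreordering g (s * ∏ j ∈ J, g j) := by
  refine ⟨fun K => if K = J then s else 0, fun K => ?_, ?_⟩
  · rw [isSOS_iff]
    dsimp only
    split_ifs
    · exact hs
    · exact IsSumSq.zero
  · simp

lemma inPre_sum {α : Type*} (A : Finset α) (f : α → MvPolynomial ι ℝ)
    (h : ∀ a ∈ A, InPreordering g (f a)) : InPreordering g (∑ a ∈ A, f a) := by
  classical
  induction A using Finset.induction_on with
  | empty =>
    have := inPre_gen g (IsSumSq.zero) ∅
    simpa using this
  | insert a s ha ih =>
    rw [Finset.sum_insert ha]
    exact inPre_add g (h a (by simp)) (ih fun b hb => h b (by simp [hb]))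

lemma isPre_inPreordering : IsPre {σ | InPreordering g σ} where
  add := inPre_add g
  mul := by
    rintro _ _ ⟨c, hc, rfl⟩ ⟨d, hd, rfl⟩
    change InPreordering g _
    rw [Finset.sum_mul_sum]
    refine inPre_sum g _ _ fun J _ => inPre_sum g _ _ fun K _ => ?_
    have h1 := (isSOS_iff _).1 (hc J)
    have h2 := (isSOS_iff _).1 (hd K)
    have e : c J * (∏ j ∈ J, g j) * (d K * ∏ j ∈ K, g j) =
        (c J * d K * ((∏ j ∈ J ∩ K, g j) * ∏ j ∈ J ∩ K, g j)) * ∏ j ∈ (J ∪ K) \ (J ∩ K), g j := by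
      have e1 := Finset.prod_union_inter (s₁ := J) (s₂ := K) (f := g)
      have e2 := Finset.prod_sdiff (s₁ := J ∩ K) (s₂ := J ∪ K) (f := g)
        (Finset.inter_subset_left.trans Finset.subset_union_left)
      rw [← e2] at e1
      linear_combination -c J * d K * e1
    rw [e]
    exact inPre_gen g ((h1.mul h2).mul (IsSumSq.mul_self _)) _
  sq := fun a => by
    have := inPre_gen g (IsSumSq.mul_self a) ∅
    simpa [pow_two] using this

lemma inPre_self (j : κ) : InPreordering g (g j) := by
  have := inPre_gen g (s := 1) (by simp) {j}
  simpa using this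

lemma isQM_inQuadraticModule {κ : Type*} [Fintype κ] (g : κ → MvPolynomial ι ℝ) :
    IsQM {σ | InQuadraticModule g σ} where
  add := by
    rintro _ _ ⟨c₀, c, h0, hc, rfl⟩ ⟨d₀, d, h0', hd, rfl⟩
    simp only [isSOS_iff] at *
    refine ⟨c₀ + d₀, c + d, ?_, fun j => ?_, ?_⟩
    · rw [isSOS_iff]; exact h0.add h0'
    · rw [isSOS_iff]; exact (hc j).add (hd j)
    · simp only [Pi.add_apply, add_mul, Finset.sum_add_distrib]; ring
  sq_mul := by
    rintro a _ ⟨c₀, c, h0, hc, rfl⟩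
    simp only [isSOS_iff] at *
    refine ⟨a * a * c₀, fun j => a * a * c j, ?_, fun j => ?_, ?_⟩
    · rw [isSOS_iff]; exact (IsSumSq.mul_self a).mul h0
    · rw [isSOS_iff]; exact (IsSumSq.mul_self a).mul (hc j)
    · rw [mul_add, Finset.mul_sum, pow_two]
      simp only [mul_assoc]
  one := ⟨1, fun _ => 0, (isSOS_iff _).2 (by simp), fun _ => (isSOS_iff _).2 IsSumSq.zero, by simp⟩

lemma inQM_self {κ : Type*} [Fintype κ] (g : κ → MvPolynomial ι ℝ) (j : κ) :
    InQuadraticModule g (g j) := by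
  classical
  refine ⟨0, fun i => if i = j then 1 else 0, (isSOS_iff _).2 IsSumSq.zero,
    fun i => (isSOS_iff _).2 ?_, by simp⟩
  dsimp only
  split_ifs
  · simp
  · exact IsSumSq.zero
end Link


/-! ### The sparse splitting -/

lemma exists_between_compact {A B : Set ℝ} (hA : IsCompact A) (hB : IsCompact B)
    (h : ∀ a ∈ A, ∀ b ∈ B, b < a) : ∃ c, (∀ a ∈ A, c < a) ∧ ∀ b ∈ B, b < c := by
  rcases A.eq_empty_or_nonempty with rfl | hA0
  · obtain ⟨M, hM⟩ := hB.bddAbove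
    exact ⟨M + 1, by simp, fun b hb => by linarith [hM hb]⟩
  · obtain ⟨a, ha, ha'⟩ := hA.exists_isLeast hA0
    obtain ⟨c', hc', hc⟩ := hB.neg.exists_forall_le' (f := id) continuousOn_id (a := -a)
      (fun b hb => by have := h a ha _ hb; simp only [id]; linarith)
    refine ⟨(a - c') / 2, fun x hx => ?_, fun b hb => ?_⟩
    · have := ha' hx
      linarith
    · have := hc (-b) (by simpa using hb)
      simp only [id] at this
      linarith

lemma exists_continuous_split {X Y Z : Type*} [TopologicalSpace X] [TopologicalSpace Y]
    [T2Space Y] [NormalSpace Y] [ParacompactSpace Y] [TopologicalSpace Z] [T2Space X] [T2Space Z]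
    {K₁ : Set (X × Y)} {K₂ : Set (Y × Z)} (h₁ : IsCompact K₁) (h₂ : IsCompact K₂)
    {F₁ : X × Y → ℝ} {F₂ : Y × Z → ℝ} (hF₁ : Continuous F₁) (hF₂ : Continuous F₂)
    (hpos : ∀ x y z, (x, y) ∈ K₁ → (y, z) ∈ K₂ → 0 < F₁ (x, y) + F₂ (y, z)) :
    ∃ q : C(Y, ℝ), (∀ w ∈ K₁, 0 < F₁ w - q w.2) ∧ ∀ w ∈ K₂, 0 < F₂ w + q w.1 := by
  obtain ⟨q, hq⟩ := exists_continuous_forall_mem_convex_of_local_const (X := Y) (E := ℝ)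
    (t := fun y => {c | (∀ x, (x, y) ∈ K₁ → c < F₁ (x, y)) ∧ ∀ z, (y, z) ∈ K₂ → -F₂ (y, z) < c})
    (by
      intro y
      refine Convex.inter (s := {c | ∀ x, (x, y) ∈ K₁ → c < F₁ (x, y)})
        (t := {c | ∀ z, (y, z) ∈ K₂ → -F₂ (y, z) < c}) ?_ ?_
      · apply Set.OrdConnected.convex
        exact ⟨fun a ha b hb c hc x hx => hc.2.trans_lt (hb x hx)⟩
      · apply Set.OrdConnected.convex
        exact ⟨fun a ha b hb c hc x hx => (ha x hx).trans_le hc.1⟩)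
    (by
      intro y
      have hc₁ : IsCompact (F₁ '' (K₁ ∩ Prod.snd ⁻¹' {y})) :=
        (h₁.inter_right (isClosed_singleton.preimage continuous_snd)).image hF₁
      have hc₂ : IsCompact ((fun w => -F₂ w) '' (K₂ ∩ Prod.fst ⁻¹' {y})) :=
        (h₂.inter_right (isClosed_singleton.preimage continuous_fst)).image hF₂.neg
      obtain ⟨c, hca, hcb⟩ := exists_between_compact hc₁ hc₂ (by
        rintro _ ⟨⟨x, y'⟩, ⟨hx, rfl⟩, rfl⟩ _ ⟨⟨y'', z⟩, ⟨hz, rfl⟩, rfl⟩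
        have := hpos x _ z hx hz
        dsimp only at this ⊢
        linarith)
      refine ⟨c, ?_⟩
      have hb₁ : IsClosed (Prod.snd '' (K₁ ∩ {w | F₁ w ≤ c})) :=
        ((h₁.inter_right (isClosed_le hF₁ continuous_const)).image continuous_snd).isClosed
      have hb₂ : IsClosed (Prod.fst '' (K₂ ∩ {w | c ≤ -F₂ w})) :=
        ((h₂.inter_right (isClosed_le continuous_const hF₂.neg)).image continuous_fst).isClosed
      have hm₁ : y ∈ (Prod.snd '' (K₁ ∩ {w | F₁ w ≤ c}))ᶜ := by
        rintro ⟨w, ⟨hw, hw'⟩, hy⟩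
        exact absurd (hca _ ⟨w, ⟨hw, hy⟩, rfl⟩) (not_lt.2 hw')
      have hm₂ : y ∈ (Prod.fst '' (K₂ ∩ {w | c ≤ -F₂ w}))ᶜ := by
        rintro ⟨w, ⟨hw, hw'⟩, hy⟩
        exact absurd (hcb _ ⟨w, ⟨hw, hy⟩, rfl⟩) (not_lt.2 hw')
      filter_upwards [hb₁.isOpen_compl.mem_nhds hm₁, hb₂.isOpen_compl.mem_nhds hm₂] with y' h3 h4
      constructor
      · intro x hx
        by_contra hcon
        exact h3 ⟨(x, y'), ⟨hx, not_lt.1 hcon⟩, rfl⟩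
      · intro z hz
        by_contra hcon
        exact h4 ⟨(y', z), ⟨hz, not_lt.1 hcon⟩, rfl⟩)
  refine ⟨q, fun w hw => ?_, fun w hw => ?_⟩
  · linarith [(hq w.2).1 w.1 hw]
  · linarith [(hq w.1).2 w.2 hw]

lemma exists_poly_near {m : ℕ} (q : C(Fin m → ℝ, ℝ)) {K : Set (Fin m → ℝ)} (hK : IsCompact K)
    {ε : ℝ} (hε : 0 < ε) : ∃ Q : MvPolynomial (Fin m) ℝ, ∀ y ∈ K, |eval y Q - q y| < ε := by
  let ev : MvPolynomial (Fin m) ℝ →ₐ[ℝ] C(Fin m → ℝ, ℝ) :=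
    aeval (fun i => (⟨fun y => y i, continuous_apply i⟩ : C(Fin m → ℝ, ℝ)))
  have hev : ∀ Q y, ev Q y = eval y Q := by
    intro Q y
    induction Q using MvPolynomial.induction_on with
    | C r => simp [ev]
    | add p q hp hq => rw [map_add, map_add, ContinuousMap.add_apply, hp, hq]
    | mul_X p i hp =>
      rw [map_mul, map_mul, ContinuousMap.mul_apply, hp]
      simp [ev]
  obtain ⟨g, ⟨Q, rfl⟩, h⟩ :=
    ContinuousMap.exists_mem_subalgebra_near_continuous_of_isCompact_of_separatesPoints
      (A := ev.range) (by
        intro x y hxy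
        obtain ⟨i, hi⟩ := Function.ne_iff.1 hxy
        exact ⟨ev (X i), ⟨ev (X i), ⟨X i, rfl⟩, rfl⟩, by simpa [hev] using hi⟩) q hK hε
  refine ⟨Q, fun y hy => ?_⟩
  have := h y hy
  rw [Real.norm_eq_abs] at this
  rw [← hev]
  exact this

theorem specialized_putinar_right
    (n m p a b : ℕ)
    (g : Fin a → MvPolynomial (Fin n ⊕ Fin m) ℝ)
    (h : Fin b → MvPolynomial (Fin m ⊕ Fin p) ℝ)
    (Kxy : Set ((Fin n → ℝ) × (Fin m → ℝ)))
    (Kyz : Set ((Fin m → ℝ) × (Fin p → ℝ)))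
    (K : Set ((Fin n → ℝ) × (Fin m → ℝ) × (Fin p → ℝ)))
    (hKxy : Kxy = {w | ∀ j, 0 ≤ eval (Sum.elim w.1 w.2) (g j)})
    (hKyz : Kyz = {w | ∀ k, 0 ≤ eval (Sum.elim w.1 w.2) (h k)})
    (hK : K = {w | (w.1, w.2.1) ∈ Kxy ∧ w.2 ∈ Kyz})
    (hKxyCompact : IsCompact Kxy) (hKyzCompact : IsCompact Kyz)
    (hKint : (interior K).Nonempty)
    (N : ℝ)
    (hN : InQuadraticModule h (C N - ∑ v : Fin m ⊕ Fin p, X v ^ 2))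
    (f : MvPolynomial (Fin n ⊕ Fin m ⊕ Fin p) ℝ)
    (f₁ : MvPolynomial (Fin n ⊕ Fin m) ℝ) (f₂ : MvPolynomial (Fin m ⊕ Fin p) ℝ)
    (hf : f = rename (Sum.map id Sum.inl) f₁ + rename Sum.inr f₂)
    (hpos : ∀ w ∈ K, 0 < eval (Sum.elim w.1 (Sum.elim w.2.1 w.2.2)) f) :
    ∃ (σ : MvPolynomial (Fin n ⊕ Fin m) ℝ) (ψ : MvPolynomial (Fin m ⊕ Fin p) ℝ),
      InPreordering g σ ∧ InQuadraticModule h ψ ∧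
      f = rename (Sum.map id Sum.inl) σ + rename Sum.inr ψ := by
  classical
  have hc₁ : Continuous fun w : (Fin n → ℝ) × (Fin m → ℝ) => eval (Sum.elim w.1 w.2) f₁ := by
    refine f₁.continuous_eval.comp (continuous_pi fun i => ?_)
    rcases i with i | i
    · exact (continuous_apply i).comp continuous_fst
    · exact (continuous_apply i).comp continuous_snd
  have hc₂ : Continuous fun w : (Fin m → ℝ) × (Fin p → ℝ) => eval (Sum.elim w.1 w.2) f₂ := by
    refine f₂.continuous_eval.comp (continuous_pi fun i => ?_)
    rcases i with i | i
    · exact (continuous_apply i).comp continuous_fst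
    · exact (continuous_apply i).comp continuous_snd
  -- a continuous splitting
  obtain ⟨q, hq₁, hq₂⟩ := exists_continuous_split hKxyCompact hKyzCompact hc₁ hc₂ (by
    intro x y z hxy hyz
    have := hpos (x, y, z) (by rw [hK]; exact ⟨hxy, hyz⟩)
    rw [hf, map_add, eval_rename, eval_rename] at this
    convert this using 3
    · congr 1
      funext i
      rcases i with i | i <;> rfl
    · rw [Sum.elim_comp_inr])
  have hq₁c : Continuous fun w : (Fin n → ℝ) × (Fin m → ℝ) =>
      eval (Sum.elim w.1 w.2) f₁ - q w.2 := hc₁.sub (q.continuous.comp continuous_snd)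
  have hq₂c : Continuous fun w : (Fin m → ℝ) × (Fin p → ℝ) =>
      eval (Sum.elim w.1 w.2) f₂ + q w.1 := hc₂.add (q.continuous.comp continuous_fst)
  obtain ⟨ε₁, hε₁, hm₁⟩ := hKxyCompact.exists_forall_le' hq₁c.continuousOn hq₁
  obtain ⟨ε₂, hε₂, hm₂⟩ := hKyzCompact.exists_forall_le' hq₂c.continuousOn hq₂
  -- a polynomial splitting
  obtain ⟨Q, hQ⟩ := exists_poly_near q
    ((hKxyCompact.image continuous_snd).union (hKyzCompact.image continuous_fst))
    (lt_min hε₁ hε₂)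
  have hp₁ : ∀ w ∈ Kxy, 0 < eval (Sum.elim w.1 w.2) (f₁ - rename Sum.inr Q) := by
    intro w hw
    have h1 := hm₁ w hw
    have h2 := abs_lt.1 ((hQ w.2 (Or.inl ⟨w, hw, rfl⟩)).trans_le (min_le_left _ _))
    rw [map_sub, eval_rename, Sum.elim_comp_inr]
    linarith
  have hp₂ : ∀ w ∈ Kyz, 0 < eval (Sum.elim w.1 w.2) (f₂ + rename Sum.inl Q) := by
    intro w hw
    have h1 := hm₂ w hw
    have h2 := abs_lt.1 ((hQ w.1 (Or.inr ⟨w, hw, rfl⟩)).trans_le (min_le_right _ _))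
    rw [map_add, eval_rename, Sum.elim_comp_inl]
    linarith
  refine ⟨f₁ - rename Sum.inr Q, f₂ + rename Sum.inl Q, ?_, ?_, ?_⟩
  · have hT := isPre_inPreordering g
    have hmem : ∀ c : Fin n ⊕ Fin m → ℝ, (∀ j, 0 ≤ eval c (g j)) →
        (c ∘ Sum.inl, c ∘ Sum.inr) ∈ Kxy := by
      intro c hc
      rw [hKxy]
      intro j
      simpa only [Sum.elim_comp_inl_inr] using hc j
    obtain ⟨B, hB⟩ := hKxyCompact.bddAbove_image
      (f := fun w : (Fin n → ℝ) × (Fin m → ℝ) => ∑ i, Sum.elim w.1 w.2 i ^ 2) (by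
        refine Continuous.continuousOn (continuous_finset_sum _ fun i _ => ?_)
        rcases i with i | i
        · exact ((continuous_apply i).comp continuous_fst).pow 2
        · exact ((continuous_apply i).comp continuous_snd).pow 2)
    have hA := hT.arch (Finset.univ.image g) (by
      intro x hx
      obtain ⟨j, -, rfl⟩ := Finset.mem_image.1 hx
      exact inPre_self g j) (B + 1) (by
      intro c hc
      have h1 := hB ⟨_, hmem c fun j => hc _ (by simp), rfl⟩
      simp only [Sum.elim_comp_inl_inr] at h1
      linarith)
    refine hT.isQM.mem_of_pos hA _ fun c hc => ?_
    have := hp₁ _ (hmem c fun j => hc _ (inPre_self g j))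
    simpa only [Sum.elim_comp_inl_inr] using this
  · have hM := isQM_inQuadraticModule h
    refine hM.mem_of_pos (hM.arch_of_ball N hN) _ fun c hc => ?_
    have := hp₂ (c ∘ Sum.inl, c ∘ Sum.inr) (by
      rw [hKyz]
      intro j
      simpa only [Sum.elim_comp_inl_inr] using hc _ (inQM_self h j))
    simpa only [Sum.elim_comp_inl_inr] using this
  · rw [hf, map_sub, map_add, rename_rename, rename_rename]
    have : (Sum.map id Sum.inl ∘ Sum.inr : Fin m → Fin n ⊕ Fin m ⊕ Fin p) = Sum.inr ∘ Sum.inl := by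
      funext i; rfl
    rw [this]
    ring
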